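/- arXiv:2512.22835 — 4 statements merged into one kernel-verified Lean document; each statement's English description precedes it below -/
import Mathlib

section
/- Let k > ℓ ≥ 1, let m ≥ 1 and λ be integers with 0 ≤ λ ≤ k+ℓ−3, and let p = (k+ℓ)m+2+λ be a prime. If A ⊆ F_p is a (k,ℓ)-sum-free set, then |A| ≤ m+1. Moreover, if |A| = m+1, then there exist c ∈ F_p ∖ {0} and j ∈ {0, ..., ⌈(λ+1)/2⌉−1} such that c·A = [a_j, a_j+m], where a_j = −(km+1+j)·(k−ℓ)^{−1} ∈ F_p. -/
open Pointwise

/-- `itSum h A` is the `h`-fold sumset `hA = A + ⋯ + A` (`h` copies), with `itSum 0 A = {0}`. -/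
def itSum {G : Type*} [AddCommMonoid G] : ℕ → Set G → Set G
  | 0, _ => {0}
  | h + 1, A => itSum h A + A

/-- `A` is `(k,ℓ)`-sum-free: the sumsets `kA` and `ℓA` are disjoint. -/
def KLFree {G : Type*} [AddCommMonoid G] (k l : ℕ) (A : Set G) : Prop :=
  itSum k A ∩ itSum l A = ∅

/-- The interval `[a, a+t] = {a, a+1, …, a+t}` in `ZMod p`. -/
def Ival {p : ℕ} (a : ZMod p) (t : ℕ) : Set (ZMod p) :=
  {x | ∃ i : ℕ, i ≤ t ∧ x = a + (i : ZMod p)}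

/-- The cuboid `[a, a+t] × F_p^{n'}` inside the model space `F_p × F_p^{n'}`. -/
def cub (p n' : ℕ) (a : ZMod p) (t : ℕ) : Set (ZMod p × (Fin n' → ZMod p)) :=
  {x | x.1 ∈ Ival a t}

/-- The element `a_j = -(km+1+j)·(k-ℓ)⁻¹` of `F_p`. -/
def ajElt (k l m p j : ℕ) : ZMod p :=
  -((k * m + 1 + j : ℕ) : ZMod p) * (((k - l : ℕ) : ZMod p))⁻¹

/-- The layer `A_i = (A - i·v) ∩ K` of `A` w.r.t. the decomposition `(v, K)`. -/
def layerKL {p n : ℕ} (v : Fin n → ZMod p) (K : Submodule (ZMod p) (Fin n → ZMod p))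
    (A : Set (Fin n → ZMod p)) (i : ZMod p) : Set (Fin n → ZMod p) :=
  {x | x ∈ K ∧ x + i • v ∈ A}

/-- The support `Supp(A) = {i | A_i ≠ ∅}` w.r.t. the decomposition `(v, K)`. -/
def supp {p n : ℕ} (v : Fin n → ZMod p) (K : Submodule (ZMod p) (Fin n → ZMod p))
    (A : Set (Fin n → ZMod p)) : Set (ZMod p) :=
  {i | (layerKL v K A i).Nonempty}

/-- The weight `ω(A) = |Supp(A)|` w.r.t. the decomposition `(v, K)`. -/
noncomputable def weight {p n : ℕ} (v : Fin n → ZMod p)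
    (K : Submodule (ZMod p) (Fin n → ZMod p)) (A : Set (Fin n → ZMod p)) : ℕ :=
  (supp v K A).ncard

/-- `A ⊆ F_p^n` is trivial: isomorphic to a subset of some extremal cuboid `A_{k,ℓ,p,j}`. -/
def IsTrivialKL (k l m lam p n : ℕ) (A : Set (Fin n → ZMod p)) : Prop :=
  ∃ (e : (Fin n → ZMod p) ≃+ (ZMod p × (Fin (n - 1) → ZMod p))) (j : ℕ),
    j < (lam + 2) / 2 ∧ e '' A ⊆ cub p (n - 1) (ajElt k l m p j) m

/-- Type 1. -/
def IsType1 (k l m lam p n : ℕ) (A : Set (Fin n → ZMod p)) : Prop :=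
  A.ncard = m * p ^ (n - 1) ∧
  ∃ (e : (Fin n → ZMod p) ≃+ (ZMod p × (Fin (n - 1) → ZMod p))) (a : ZMod p),
    ((l : ZMod p) * a - (k : ZMod p) * (a + (m : ZMod p) - 1) ∈ Ival (1 : ZMod p) (l - 1) ∨
      (lam + l + 2 ≤ k ∧
        (l : ZMod p) * a - (k : ZMod p) * (a + (m : ZMod p) - 1) ∈
          Ival ((lam + l + 2 : ℕ) : ZMod p) (k - (lam + l + 2)))) ∧
    e '' A = cub p (n - 1) a (m - 1)

/-- The element `a = m·k·(ℓ-k)⁻¹` of `F_p` used in type 2. -/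
def type2a (k l m p : ℕ) : ZMod p :=
  (m : ZMod p) * (k : ZMod p) * (((l : ZMod p) - (k : ZMod p))⁻¹)

/-- Type 2. -/
def IsType2 (k l m p n : ℕ) (A : Set (Fin n → ZMod p)) : Prop :=
  l = 1 ∧ 2 ≤ n ∧ A.ncard = m * p ^ (n - 1) ∧
  ∃ (e : (Fin n → ZMod p) ≃+ (ZMod p × (Fin (n - 1) → ZMod p)))
      (V : Submodule (ZMod p) (Fin (n - 1) → ZMod p)),
    V ≠ ⊤ ∧
    e '' A =
      ({type2a k l m p} ×ˢ (Set.univ \ (V : Set (Fin (n - 1) → ZMod p)))) ∪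
        ((Ival (type2a k l m p + 1) (m - 2)) ×ˢ (Set.univ : Set (Fin (n - 1) → ZMod p))) ∪
        ({type2a k l m p + (m : ZMod p)} ×ˢ (V : Set (Fin (n - 1) → ZMod p)))

/-- Normal: of type 1 or type 2. -/
def IsNormalKL (k l m lam p n : ℕ) (A : Set (Fin n → ZMod p)) : Prop :=
  IsType1 k l m lam p n A ∨ IsType2 k l m p n A

/-- The element `a = (ℓm+k-1)·(k-ℓ)⁻¹` of `F_p` used in type 3. -/
def type3a (k l m p : ℕ) : ZMod p :=
  ((l * m + k - 1 : ℕ) : ZMod p) * (((k - l : ℕ) : ZMod p))⁻¹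

/-- Type 3. -/
def IsType3 (k l m p n : ℕ) (A : Set (Fin n → ZMod p)) : Prop :=
  A.ncard = m * p ^ (n - 1) ∧
  ∃ e : (Fin n → ZMod p) ≃+ (ZMod p × (Fin (n - 1) → ZMod p)),
    e '' A = {x | x.1 ∈ Ival (type3a k l m p - 1) (m + 1) \
      {type3a k l m p, type3a k l m p + (m : ZMod p) - 1}}

/-- Type 4 (for `p = 5m+3`). -/
def IsType4 (m p n : ℕ) (A : Set (Fin n → ZMod p)) : Prop :=
  2 ≤ n ∧ A.ncard = m * p ^ (n - 1) ∧
  ∃ (e : (Fin n → ZMod p) ≃+ (ZMod p × (Fin (n - 1) → ZMod p)))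
      (V : Submodule (ZMod p) (Fin (n - 1) → ZMod p)),
    V ≠ ⊤ ∧
    e '' A =
      (({((2 * m + 1 : ℕ) : ZMod p), ((3 * m + 2 : ℕ) : ZMod p)} : Set (ZMod p)) ×ˢ
          (V : Set (Fin (n - 1) → ZMod p))) ∪
        (({((2 * m + 2 : ℕ) : ZMod p), ((3 * m + 1 : ℕ) : ZMod p)} : Set (ZMod p)) ×ˢ
          (Set.univ \ (V : Set (Fin (n - 1) → ZMod p)))) ∪
        ((Ival ((2 * m + 3 : ℕ) : ZMod p) (m - 3)) ×ˢ (Set.univ : Set (Fin (n - 1) → ZMod p)))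

/-- The set `A₀ ⊆ F_p × F_p^s` used in type 5 (for `p = 4m+3`), with `a = (m+2)/2`. -/
def type5A0 (m p s : ℕ) (P : Set (Fin s → ZMod p)) : Set (ZMod p × (Fin s → ZMod p)) :=
  {(((m + 2 : ℕ) : ZMod p) * (2 : ZMod p)⁻¹ - 1, (0 : Fin s → ZMod p))} ∪
    ({((m + 2 : ℕ) : ZMod p) * (2 : ZMod p)⁻¹} ×ˢ (Set.univ \ P)) ∪
    ((Ival (((m + 2 : ℕ) : ZMod p) * (2 : ZMod p)⁻¹ + 1) (m - 3)) ×ˢ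
      (Set.univ : Set (Fin s → ZMod p))) ∪
    ({((m + 2 : ℕ) : ZMod p) * (2 : ZMod p)⁻¹ + (m : ZMod p) - 1} ×ˢ
      (Set.univ \ {(0 : Fin s → ZMod p)})) ∪
    ({((m + 2 : ℕ) : ZMod p) * (2 : ZMod p)⁻¹ + (m : ZMod p)} ×ˢ P)

/-- Type 5 (for `p = 4m+3`). -/
def IsType5 (m p n : ℕ) (A : Set (Fin n → ZMod p)) : Prop :=
  A.ncard = m * p ^ (n - 1) ∧
  ∃ s : ℕ, s ≤ n - 1 ∧
    ∃ (e : (Fin n → ZMod p) ≃+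
          (ZMod p × (Fin s → ZMod p) × (Fin (n - 1 - s) → ZMod p)))
      (P : Set (Fin s → ZMod p)),
      P.Nonempty ∧ (0 : Fin s → ZMod p) ∉ itSum 3 P ∧
      e '' A = {x | (x.1, x.2.1) ∈ type5A0 m p s P}

/-- `τ` is feasible for `c`. -/
def Feasible (c τ : ℝ) : Prop :=
  ∀ q : ℕ, q.Prime → ∀ B : Set (ZMod q),
    (B.ncard : ℝ) ≤ c * q →
    ((B + B).ncard : ℝ) ≤ (2 + τ) * (B.ncard : ℝ) - 3 →
    ∃ y d : ZMod q, d ≠ 0 ∧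
      B ⊆ {x | ∃ i : ℕ, i ≤ (B + B).ncard - B.ncard ∧ x = y + (i : ZMod q) * d}

section Vosper

open Finset

variable {p : ℕ} [Fact p.Prime]

/-- `X` is an arithmetic progression with difference `d`. -/
def IsArithProg (d : ZMod p) (X : Finset (ZMod p)) : Prop :=
  ∃ (a : ZMod p) (n : ℕ), X = (range n).image fun i : ℕ => a + i * d

theorem exists_eq_add_natCast_mul {d : ZMod p} (hd : d ≠ 0) (x y : ZMod p) :
    ∃ n : ℕ, y = x + n * d := by
  refine ⟨((y - x) * d⁻¹).val, ?_⟩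
  rw [ZMod.natCast_zmod_val]
  field_simp
  ring

theorem eq_univ_of_add_mem {d : ZMod p} (hd : d ≠ 0) {X : Finset (ZMod p)} (hX : X.Nonempty)
    (h : ∀ x ∈ X, x + d ∈ X) : X = univ := by
  obtain ⟨x, hx⟩ := hX
  have key : ∀ n : ℕ, x + n * d ∈ X := by
    intro n
    induction n with
    | zero => simpa using hx
    | succ n ih =>
      have := h _ ih
      rwa [add_assoc, ← add_one_mul, ← Nat.cast_succ] at this
  ext y
  obtain ⟨n, rfl⟩ := exists_eq_add_natCast_mul hd x y
  simp [key n]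

theorem IsArithProg.neg {d : ZMod p} {X : Finset (ZMod p)} (h : IsArithProg d X) :
    IsArithProg d (-X) := by
  obtain ⟨a, n, rfl⟩ := h
  refine ⟨-a - ((n - 1 : ℕ) : ZMod p) * d, n, ?_⟩
  have cast_sub : ∀ i < n, ((n - 1 - i : ℕ) : ZMod p) = ((n - 1 : ℕ) : ZMod p) - i :=
    fun i hi => Nat.cast_sub (by omega)
  ext y
  simp only [mem_neg, mem_image, mem_range]
  constructor
  · rintro ⟨_, ⟨i, hi, rfl⟩, rfl⟩
    refine ⟨n - 1 - i, by omega, ?_⟩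
    rw [cast_sub i hi]
    ring
  · rintro ⟨i, hi, rfl⟩
    refine ⟨_, ⟨n - 1 - i, by omega, rfl⟩, ?_⟩
    rw [cast_sub i hi]
    ring

theorem isArithProg_of_card_add_pair_le {d : ZMod p} (hd : d ≠ 0) {X : Finset (ZMod p)}
    (h : #(X + {0, d}) ≤ #X + 1) : IsArithProg d X := by
  rcases X.eq_empty_or_nonempty with rfl | hne
  · exact ⟨0, 0, by simp⟩
  by_cases huniv : X = univ
  · refine ⟨0, p, ?_⟩
    rw [huniv]
    ext y
    simp only [mem_univ, mem_image, mem_range, true_iff]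
    refine ⟨(y * d⁻¹).val, ZMod.val_lt _, ?_⟩
    rw [ZMod.natCast_zmod_val]
    field_simp
    ring
  obtain ⟨a, ha, had⟩ : ∃ a ∈ X, a + d ∉ X := by
    by_contra! hcon
    exact huniv (eq_univ_of_add_mem hd hne hcon)
  have huniq : ∀ x ∈ X, x ≠ a → x + d ∈ X := by
    intro x hx hxa
    by_contra hxd
    have hsub : insert (x + d) (insert (a + d) X) ⊆ X + {0, d} := by
      intro y hy
      simp only [mem_insert] at hy
      rcases hy with rfl | rfl | hy
      · exact add_mem_add hx (by simp)
      · exact add_mem_add ha (by simp)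
      · simpa using add_mem_add hy (show (0 : ZMod p) ∈ ({0, d} : Finset (ZMod p)) by simp)
    have hcard := card_le_card hsub
    rw [card_insert_of_notMem (by simp [hxa, hxd]), card_insert_of_notMem had] at hcard
    omega
  have hex : ∃ n : ℕ, a - n * d ∉ X := by
    by_contra! hcon
    refine huniv (eq_univ_iff_forall.2 fun y => ?_)
    obtain ⟨n, hn⟩ := exists_eq_add_natCast_mul hd y a
    simpa [hn] using hcon n
  classical
  suffices hX : IsArithProg d (-X) by simpa using hX.neg
  refine ⟨-a, Nat.find hex, ?_⟩
  ext y
  simp only [mem_neg, mem_image, mem_range]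
  constructor
  · rintro ⟨x, hx, rfl⟩
    have hr := exists_eq_add_natCast_mul hd x a
    have hrs := Nat.find_spec hr
    have hmem : ∀ i ≤ Nat.find hr, x + i * d ∈ X := by
      intro i
      induction i with
      | zero => intro _; simpa using hx
      | succ i ih =>
        intro hi
        have hne := Nat.find_min hr (m := i) (by omega)
        have := huniq _ (ih (by omega)) (Ne.symm hne)
        rwa [add_assoc, ← add_one_mul, ← Nat.cast_succ] at this
    refine ⟨Nat.find hr, ?_, ?_⟩
    · by_contra! hle
      apply Nat.find_spec hex
      convert hmem (Nat.find hr - Nat.find hex) (by omega) using 1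
      rw [Nat.cast_sub hle]
      linear_combination hrs
    · linear_combination -hrs
  · rintro ⟨i, hi, rfl⟩
    refine ⟨a - i * d, ?_, by ring⟩
    by_contra hcon
    exact Nat.find_min hex hi hcon

theorem IsArithProg.compl {d : ZMod p} (hd : d ≠ 0) {X : Finset (ZMod p)}
    (h : IsArithProg d X) : IsArithProg d Xᶜ := by
  obtain ⟨a, n, rfl⟩ := h
  refine isArithProg_of_card_add_pair_le hd ((card_le_card ?_).trans (card_insert_le a _))
  intro z hz
  obtain ⟨y, hy, w, hw, rfl⟩ := mem_add.1 hz
  simp only [mem_insert, mem_singleton] at hw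
  rcases hw with rfl | rfl
  · simpa using Or.inr hy
  · simp only [mem_insert, mem_compl, or_iff_not_imp_right, not_not]
    intro hyd
    obtain ⟨i, hi, hiy⟩ := mem_image.1 hyd
    rcases i with _ | i
    · simpa using hiy.symm
    · refine absurd (mem_image.2 ⟨i, ?_, ?_⟩) (mem_compl.1 hy)
      · simp only [mem_range] at hi ⊢
        omega
      · push_cast at hiy
        linear_combination hiy

theorem IsArithProg.add {d : ZMod p} {X Y : Finset (ZMod p)} (hX : IsArithProg d X)
    (hY : IsArithProg d Y) (hXne : X.Nonempty) (hYne : Y.Nonempty) : IsArithProg d (X + Y) := by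
  obtain ⟨a, n, rfl⟩ := hX
  obtain ⟨b, m, rfl⟩ := hY
  have hn : n ≠ 0 := by rintro rfl; simp at hXne
  have hm : m ≠ 0 := by rintro rfl; simp at hYne
  refine ⟨a + b, n + m - 1, ?_⟩
  ext z
  simp only [mem_add, mem_image, mem_range]
  constructor
  · rintro ⟨_, ⟨i, hi, rfl⟩, _, ⟨j, hj, rfl⟩, rfl⟩
    refine ⟨i + j, by omega, ?_⟩
    push_cast
    ring
  · rintro ⟨i, hi, rfl⟩
    refine ⟨_, ⟨min i (n - 1), by omega, rfl⟩, _, ⟨i - min i (n - 1), by omega, rfl⟩, ?_⟩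
    rw [Nat.cast_sub (min_le_left _ _)]
    ring

/-- If one summand of a critical pair is an arithmetic progression, then so is the other. -/
theorem IsArithProg.of_card_add_lt {d : ZMod p} (hd : d ≠ 0) {A B : Finset (ZMod p)}
    (hB : IsArithProg d B) (hB2 : 2 ≤ #B) (hlt : #(A + B) < p)
    (hcrit : #(A + B) < #A + #B) : IsArithProg d A := by
  rcases A.eq_empty_or_nonempty with rfl | hA
  · exact ⟨0, 0, by simp⟩
  obtain ⟨b, n, rfl⟩ := hB
  have hn : 2 ≤ n := hB2.trans (card_image_le.trans (card_range n).le)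
  obtain ⟨n, rfl⟩ := Nat.exists_eq_add_of_le' hn
  set B' := (range (n + 1)).image fun i : ℕ => b + i * d with hB'
  have hB'ne : B'.Nonempty := by simp [hB']
  have hsplit : (range (n + 2)).image (fun i : ℕ => b + i * d) = {0, d} + B' := by
    ext z
    simp only [hB', mem_add, mem_image, mem_range, mem_insert, mem_singleton]
    constructor
    · rintro ⟨i, hi, rfl⟩
      rcases i with _ | i
      · exact ⟨0, Or.inl rfl, b, ⟨0, by omega, by simp⟩, by simp⟩
      · refine ⟨d, Or.inr rfl, _, ⟨i, by omega, rfl⟩, ?_⟩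
        push_cast
        ring
    · rintro ⟨_, rfl | rfl, _, ⟨i, hi, rfl⟩, rfl⟩
      · exact ⟨i, by omega, by simp⟩
      · refine ⟨i + 1, by omega, ?_⟩
        push_cast
        ring
  have hcard : #((range (n + 2)).image fun i : ℕ => b + i * d) ≤ #B' + 1 := by
    rw [range_add_one, image_insert]
    exact card_insert_le _ _
  have hcd := ZMod.cauchy_davenport (Fact.out : p.Prime)
    (hA.add (⟨0, by simp⟩ : ({0, d} : Finset (ZMod p)).Nonempty)) hB'ne
  rw [add_assoc, ← hsplit] at hcd
  refine isArithProg_of_card_add_pair_le hd ?_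
  have := hB'ne.card_pos
  omega

theorem isArithProg_of_card_eq_two {B : Finset (ZMod p)} (hB : #B = 2) :
    ∃ d : ZMod p, d ≠ 0 ∧ IsArithProg d B := by
  obtain ⟨x, y, hxy, rfl⟩ := card_eq_two.1 hB
  refine ⟨y - x, sub_ne_zero.2 hxy.symm, x, 2, ?_⟩
  simp [range_add_one, pair_comm]

/-- If `A + B` is critical, then its complement and `-A` also form a critical pair. -/
theorem isArithProg_of_isArithProg_add {d : ZMod p} (hd : d ≠ 0) {A B : Finset (ZMod p)}
    (hA : 2 ≤ #A) (hB : 2 ≤ #B) (hlt : #(A + B) + 2 ≤ p) (hcrit : #(A + B) < #A + #B)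
    (h : IsArithProg d (A + B)) : IsArithProg d A ∧ IsArithProg d B := by
  have hDcard : #(A + B)ᶜ = p - #(A + B) := by rw [card_compl, ZMod.card]
  have hsub : -A + (A + B)ᶜ ⊆ Bᶜ := by
    intro z hz
    obtain ⟨x, hx, y, hy, rfl⟩ := mem_add.1 hz
    rw [mem_compl] at hy ⊢
    intro hcon
    apply hy
    simpa using add_mem_add (mem_neg'.1 hx) hcon
  have hle := card_le_card hsub
  rw [card_compl, ZMod.card] at hle
  have hnegA : IsArithProg d (-A) :=
    (h.compl hd).of_card_add_lt hd (by omega) (by omega) (by rw [card_neg]; omega)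
  have hAP : IsArithProg d A := by simpa using hnegA.neg
  exact ⟨hAP, hAP.of_card_add_lt hd hA (by rw [add_comm]; omega) (by rw [add_comm]; omega)⟩

/-- In a critical pair with `3 ≤ #B`, some Dyson transform strictly shrinks `B` to at least two
elements. -/
theorem exists_card_addDysonETransform {A B : Finset (ZMod p)} (hA : 2 ≤ #A) (hB : 3 ≤ #B)
    (hlt : #(A + B) + 2 ≤ p) (hcrit : #(A + B) < #A + #B) :
    ∃ e : ZMod p, 2 ≤ #(addDysonETransform e (A, B)).2 ∧
      #(addDysonETransform e (A, B)).2 < #B := by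
  have hp : p.Prime := Fact.out
  have hAne : A.Nonempty := card_pos.1 (by omega)
  have hBne : B.Nonempty := card_pos.1 (by omega)
  have hcd := ZMod.cauchy_davenport hp hAne hBne
  have hBle : #B ≤ #(A + B) := card_le_card_add_left hAne
  have hAle : #A ≤ #(A + B) := card_le_card_add_right hBne
  have mem_snd : ∀ e x : ZMod p,
      x ∈ (addDysonETransform e (A, B)).2 ↔ x ∈ B ∧ e + x ∈ A := by
    intro e x
    simp [addDysonETransform, mem_vadd_finset, neg_add_eq_iff_eq_add]
  by_contra! hcon
  have hcdsub := ZMod.cauchy_davenport hp hAne hBne.neg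
  rw [card_neg] at hcdsub
  set X : Finset (ZMod p) := univ.filter fun e => #(addDysonETransform e (A, B)).2 = 1 with hX
  set Y : Finset (ZMod p) := univ.filter fun e => (addDysonETransform e (A, B)).2 = B with hY
  have hcover : A + -B ⊆ X ∪ Y := by
    intro e he
    obtain ⟨a, ha, b, hb, rfl⟩ := mem_add.1 he
    have hmem : -b ∈ (addDysonETransform (a + b) (A, B)).2 := by
      rw [mem_snd]
      exact ⟨mem_neg'.1 hb, by simpa using ha⟩
    have hpos := card_pos.2 ⟨_, hmem⟩
    simp only [hX, hY, mem_union, mem_filter, mem_univ, true_and, or_iff_not_imp_left]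
    intro hne
    exact eq_of_subset_of_card_le (fun x hx => ((mem_snd _ _).1 hx).1) (hcon _ (by omega))
  have hXY := (card_le_card hcover).trans (card_union_le X Y)
  have hYB : Y.Nonempty → #Y + #B ≤ #A + 1 := by
    intro hYne
    have hsub : Y + B ⊆ A := by
      intro z hz
      obtain ⟨e, he, b, hb, rfl⟩ := mem_add.1 hz
      rw [hY, mem_filter] at he
      rw [← he.2, mem_snd] at hb
      exact hb.2
    have := card_le_card hsub
    have := ZMod.cauchy_davenport hp hYne hBne
    omega
  have hXB : #B < #X := by
    rcases Y.eq_empty_or_nonempty with h0 | hYne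
    · rw [h0, card_empty] at hXY
      omega
    · have := hYB hYne
      omega
  have hsing : ∀ e : ZMod p, ∃ b, e ∈ X → (addDysonETransform e (A, B)).2 = {b} := by
    intro e
    by_cases he : e ∈ X
    · obtain ⟨b, hb⟩ := card_eq_one.1 (mem_filter.1 he).2
      exact ⟨b, fun _ => hb⟩
    · exact ⟨0, fun h => absurd h he⟩
  choose f hf using hsing
  have hfB : ∀ e ∈ X, f e ∈ B ∧ e + f e ∈ A := by
    intro e he
    rw [← mem_snd, hf e he]
    exact mem_singleton_self _
  obtain ⟨e₁, he₁, e₂, he₂, hne, hfe⟩ :=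
    exists_ne_map_eq_of_card_lt_of_maps_to hXB (f := f) fun e he => (hfB e he).1
  have hfst : ∀ e ∈ X, (addDysonETransform e (A, B)).1 + {f e} = A + B := by
    intro e he
    have hsub := addDysonETransform.subset e (A, B)
    have hcard := addDysonETransform.card e (A, B)
    rw [hf e he] at hsub hcard
    refine eq_of_subset_of_card_le hsub ?_
    rw [card_add_singleton]
    rw [card_singleton] at hcard
    simp only at hcard
    omega
  have heq : (addDysonETransform e₁ (A, B)).1 = (addDysonETransform e₂ (A, B)).1 := by
    have := (hfst e₁ he₁).trans (hfst e₂ he₂).symm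
    rw [hfe, add_singleton, add_singleton] at this
    exact vadd_left_cancel _ this
  have hstab : ∀ x ∈ B.erase (f e₁), x + (e₁ - e₂) ∈ B.erase (f e₁) := by
    intro x hx
    obtain ⟨hxne, hxB⟩ := mem_erase.1 hx
    have hnotA : e₁ + x ∉ A := by
      intro hxA
      have : x ∈ (addDysonETransform e₁ (A, B)).2 := (mem_snd _ _).2 ⟨hxB, hxA⟩
      rw [hf e₁ he₁, mem_singleton] at this
      exact hxne this
    have hmem : e₁ + x ∈ (addDysonETransform e₁ (A, B)).1 := by
      simp [addDysonETransform, mem_vadd_finset, hxB]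
    rw [heq] at hmem
    have hmem' : ∃ y ∈ B, e₂ + y = e₁ + x := by
      simpa [addDysonETransform, mem_vadd_finset, hnotA] using hmem
    obtain ⟨y, hy, hyx⟩ := hmem'
    have hyeq : x + (e₁ - e₂) = y := by linear_combination -hyx
    rw [hyeq]
    refine mem_erase.2 ⟨?_, hy⟩
    rintro rfl
    apply hnotA
    rw [← hyx, hfe]
    exact (hfB e₂ he₂).2
  have hcardErase := card_erase_of_mem (hfB e₁ he₁).1
  have huniv := eq_univ_of_add_mem (sub_ne_zero.2 hne) (card_pos.1 (by omega)) hstab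
  rw [huniv, card_univ, ZMod.card] at hcardErase
  omega

/-- **Vosper's theorem**. -/
theorem ZMod.vosper {A B : Finset (ZMod p)} (hA : 2 ≤ #A) (hB : 2 ≤ #B)
    (hlt : #(A + B) + 2 ≤ p) (hcrit : #(A + B) < #A + #B) :
    ∃ d : ZMod p, d ≠ 0 ∧ IsArithProg d A ∧ IsArithProg d B := by
  induction hn : #B using Nat.strong_induction_on generalizing A B with
  | _ n ih =>
  subst hn
  rcases hB.eq_or_lt with h2 | h3
  · obtain ⟨d, hd, hBd⟩ := isArithProg_of_card_eq_two h2.symm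
    exact ⟨d, hd, hBd.of_card_add_lt hd hB (by omega) hcrit, hBd⟩
  · obtain ⟨e, he2, heB⟩ := exists_card_addDysonETransform hA h3 hlt hcrit
    have hsub := addDysonETransform.subset e (A, B)
    have hcard := addDysonETransform.card e (A, B)
    set A' := (addDysonETransform e (A, B)).1
    set B' := (addDysonETransform e (A, B)).2
    simp only at hsub hcard
    have hsubcard := card_le_card hsub
    have hA' : 2 ≤ #A' := by omega
    have hA'ne : A'.Nonempty := card_pos.1 (by omega)
    have hB'ne : B'.Nonempty := card_pos.1 (by omega)
    obtain ⟨d, hd, hA'd, hB'd⟩ := ih _ heB hA' he2 (by omega) (by omega) rfl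
    have hcd := ZMod.cauchy_davenport (Fact.out : p.Prime) hA'ne hB'ne
    have heq : A' + B' = A + B := eq_of_subset_of_card_le hsub (by omega)
    have hAB := hA'd.add hB'd hA'ne hB'ne
    rw [heq] at hAB
    exact ⟨d, hd, isArithProg_of_isArithProg_add hd hA hB hlt hcrit hAB⟩

end Vosper

section SumFree

open Finset

variable {p : ℕ} [Fact p.Prime]

theorem exists_finset_itSum_card {S : Finset (ZMod p)} {N c : ℕ} (hS : S.Nonempty)
    (hgrow : ∀ T : Finset (ZMod p), #S ≤ #T → min N (#T + c) ≤ #(T + S)) (h : ℕ) :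
    ∃ T : Finset (ZMod p), (T : Set (ZMod p)) = itSum (h + 1) (S : Set (ZMod p)) ∧
      #S ≤ #T ∧ min N (#S + h * c) ≤ #T := by
  induction h with
  | zero => exact ⟨S, by simp [itSum], le_rfl, by simp⟩
  | succ h ih =>
    obtain ⟨T, hT, hST, hN⟩ := ih
    refine ⟨T + S, ?_, hST.trans (card_le_card_add_right hS), ?_⟩
    · rw [coe_add, hT]
      rfl
    · have := hgrow T hST
      rw [add_mul, one_mul]
      omega

theorem not_klFree_of_card_add {k l m lam : ℕ} (hlk : l < k) (hl : 1 ≤ l) (hm : 1 ≤ m)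
    (hlam : lam ≤ k + l - 3) (hp : p = (k + l) * m + 2 + lam) {S : Finset (ZMod p)}
    (hS : m + 1 ≤ #S)
    (hgrow : ∀ T : Finset (ZMod p), #S ≤ #T → min (p - 1) (#T + (m + 1)) ≤ #(T + S)) :
    ¬ KLFree k l (S : Set (ZMod p)) := by
  intro hfree
  have hSne : S.Nonempty := card_pos.1 (by omega)
  obtain ⟨k, rfl⟩ := Nat.exists_eq_add_of_le' (by omega : 1 ≤ k)
  obtain ⟨l, rfl⟩ := Nat.exists_eq_add_of_le' hl
  obtain ⟨K, hK, hSK, hKcard⟩ := exists_finset_itSum_card hSne hgrow k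
  obtain ⟨L, hL, hSL, hLcard⟩ := exists_finset_itSum_card hSne hgrow l
  have hdisj : Disjoint K L := by
    rw [KLFree, ← hK, ← hL, ← Set.disjoint_iff_inter_eq_empty] at hfree
    exact_mod_cast hfree
  have hle := card_le_univ (K ∪ L)
  rw [card_union_of_disjoint hdisj, ZMod.card] at hle
  have hexp : (k + 1 + (l + 1)) * m + (k + l) = k * (m + 1) + l * (m + 1) + 2 * m := by ring
  omega

theorem card_le_of_klFree {k l m lam : ℕ} (hlk : l < k) (hl : 1 ≤ l) (hm : 1 ≤ m)
    (hlam : lam ≤ k + l - 3) (hp : p = (k + l) * m + 2 + lam) {S : Finset (ZMod p)}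
    (hfree : KLFree k l (S : Set (ZMod p))) : #S ≤ m + 1 := by
  by_contra! hlt
  refine not_klFree_of_card_add hlk hl hm hlam hp (by omega) (fun T hT => ?_) hfree
  have := ZMod.cauchy_davenport (Fact.out : p.Prime) (card_pos.1 (by omega : 0 < #T))
    (card_pos.1 (by omega : 0 < #S))
  omega

theorem exists_isArithProg_of_klFree {k l m lam : ℕ} (hlk : l < k) (hl : 1 ≤ l) (hm : 1 ≤ m)
    (hlam : lam ≤ k + l - 3) (hp : p = (k + l) * m + 2 + lam) {S : Finset (ZMod p)}
    (hS : #S = m + 1) (hfree : KLFree k l (S : Set (ZMod p))) :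
    ∃ d : ZMod p, d ≠ 0 ∧ IsArithProg d S := by
  by_contra hcon
  refine not_klFree_of_card_add hlk hl hm hlam hp hS.ge (fun T hT => ?_) hfree
  by_contra hsmall
  obtain ⟨d, hd, -, hSd⟩ := ZMod.vosper (A := T) (B := S) (by omega) (by omega) (by omega)
    (by omega)
  exact hcon ⟨d, hd, hSd⟩

theorem IsArithProg.exists_eq_image_range_card {d : ZMod p} (hd : d ≠ 0) {X : Finset (ZMod p)}
    (h : IsArithProg d X) (hX : #X < p) :
    ∃ a : ZMod p, X = (range #X).image fun i : ℕ => a + i * d := by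
  obtain ⟨a, n, rfl⟩ := h
  have hinj : ∀ N ≤ p, #((range N).image fun i : ℕ => a + i * d) = N := by
    intro N hN
    rw [card_image_of_injOn, card_range]
    intro i hi j hj hij
    simp only [coe_range, Set.mem_Iio] at hi hj
    have hcast : (i : ZMod p) = j := mul_right_cancel₀ hd (add_left_cancel hij)
    have := congrArg ZMod.val hcast
    rwa [ZMod.val_cast_of_lt (by omega), ZMod.val_cast_of_lt (by omega)] at this
  refine ⟨a, ?_⟩
  rw [hinj n]
  by_contra! hn
  have hsub : (range p).image (fun i : ℕ => a + i * d) ⊆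
      (range n).image fun i : ℕ => a + i * d :=
    image_subset_image (range_mono hn.le)
  have := card_le_card hsub
  rw [hinj p le_rfl] at this
  omega

end SumFree

theorem mem_itSum_of_mem_arithProg {p : ℕ} {A : Set (ZMod p)} {a d : ZMod p} {m : ℕ}
    (hA : ∀ i ≤ m, a + (i : ℕ) * d ∈ A) (h i : ℕ) (hi : i ≤ h * m) :
    (h : ZMod p) * a + i * d ∈ itSum h A := by
  induction h generalizing i with
  | zero =>
    obtain rfl : i = 0 := by omega
    simp [itSum]
  | succ h ih =>
    rw [add_mul, one_mul] at hi
    refine Set.mem_add.2 ⟨_, ih (i - min i m) (by omega), _, hA (min i m) (by omega), ?_⟩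
    rw [Nat.cast_sub (min_le_left _ _)]
    push_cast
    ring

/-- The first term of a `(k,ℓ)`-sum-free progression of length `m + 1`. -/
theorem exists_sub_mul_eq_of_klFree {k l m lam p : ℕ} [Fact p.Prime]
    (hp : p = (k + l) * m + 2 + lam) {A : Set (ZMod p)} {a d : ZMod p} (hd : d ≠ 0)
    (hA : ∀ i ≤ m, a + (i : ℕ) * d ∈ A) (hfree : KLFree k l A) :
    ∃ j ≤ lam, ((k : ZMod p) - l) * (a * d⁻¹) = -((k * m + 1 + j : ℕ) : ZMod p) := by
  set x : ZMod p := ((k : ZMod p) - l) * (a * d⁻¹) with hx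
  have hxd : x * d = ((k : ZMod p) - l) * a := by
    rw [hx]
    field_simp
  have hval : ((x.val : ℕ) : ZMod p) = x := ZMod.natCast_zmod_val x
  have hvlt := ZMod.val_lt x
  have hexp : (k + l) * m = k * m + l * m := add_mul _ _ _
  have habs : ∀ i ≤ k * m, ∀ j ≤ l * m, (j : ZMod p) ≠ x + i := by
    intro i hi j hj hij
    have h1 := mem_itSum_of_mem_arithProg hA k i hi
    have h2 := mem_itSum_of_mem_arithProg hA l j hj
    have heq : (k : ZMod p) * a + i * d = (l : ZMod p) * a + j * d := by
      rw [hij]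
      linear_combination -hxd
    rw [← heq] at h2
    have : (k : ZMod p) * a + i * d ∈ itSum k A ∩ itSum l A := ⟨h1, h2⟩
    rw [KLFree] at hfree
    simp [hfree] at this
  have hlow : l * m < x.val := by
    by_contra! hle
    exact habs 0 (Nat.zero_le _) x.val hle (by simp [hval])
  have hhigh : x.val + k * m < p := by
    by_contra! hle
    refine habs (p - x.val) (by omega) 0 (Nat.zero_le _) ?_
    rw [Nat.cast_sub hvlt.le, hval]
    simp
  refine ⟨p - x.val - (k * m + 1), by omega, ?_⟩
  rw [show k * m + 1 + (p - x.val - (k * m + 1)) = p - x.val by omega, Nat.cast_sub hvlt.le, hval]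
  simp

theorem inv_smul_eq_ival_ajElt {k l m p j : ℕ} [Fact p.Prime] (hlk : l < k) (hkp : k < p)
    {A : Set (ZMod p)} {a d : ZMod p} (hd : d ≠ 0)
    (hA : ∀ x, x ∈ A ↔ ∃ i ≤ m, x = a + (i : ℕ) * d)
    (h : ((k : ZMod p) - l) * (a * d⁻¹) = -((k * m + 1 + j : ℕ) : ZMod p)) :
    d⁻¹ • A = Ival (ajElt k l m p j) m := by
  have hkl : ((k - l : ℕ) : ZMod p) ≠ 0 := by
    rw [Ne, ZMod.natCast_eq_zero_iff]
    exact Nat.not_dvd_of_pos_of_lt (by omega) (by omega)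
  have haj : ajElt k l m p j = a * d⁻¹ := by
    rw [ajElt, ← h, ← Nat.cast_sub hlk.le]
    field_simp
  ext x
  rw [Set.mem_smul_set_iff_inv_smul_mem₀ (inv_ne_zero hd), inv_inv, smul_eq_mul, hA, haj]
  refine exists_congr fun i => and_congr_right fun _ => ?_
  constructor
  · intro hx
    field_simp
    linear_combination hx
  · rintro rfl
    field_simp

/-- A `(k,ℓ)`-sum-free subset of `F_p` has at most `m+1` elements, and in
the extremal case it is, up to multiplication by a nonzero scalar, one of the intervals
`[a_j, a_j+m]` with `j < ⌈(λ+1)/2⌉`. -/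
theorem stmt8 (k l m lam p : ℕ) (hlk : l < k) (hl : 1 ≤ l) (hm : 1 ≤ m)
    (hlam : lam ≤ k + l - 3) (hp : p = (k + l) * m + 2 + lam) (hpp : p.Prime)
    (A : Set (ZMod p)) (hA : A.Nonempty) (hfree : KLFree k l A) :
    A.ncard ≤ m + 1 ∧
      (A.ncard = m + 1 →
        ∃ (c : ZMod p) (j : ℕ), c ≠ 0 ∧ j < (lam + 2) / 2 ∧
          c • A = Ival (ajElt k l m p j) m) := by
  have : Fact p.Prime := ⟨hpp⟩
  obtain ⟨S, rfl⟩ : ∃ S : Finset (ZMod p), (S : Set (ZMod p)) = A :=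
    ⟨A.toFinite.toFinset, A.toFinite.coe_toFinset⟩
  rw [Set.ncard_coe_finset]
  refine ⟨card_le_of_klFree hlk hl hm hlam hp hfree, fun hS => ?_⟩
  have hkm : k + l ≤ (k + l) * m := Nat.le_mul_of_pos_right _ hm
  have hml : m ≤ (k + l) * m := Nat.le_mul_of_pos_left _ (by omega)
  obtain ⟨d, hd, hSd⟩ := exists_isArithProg_of_klFree hlk hl hm hlam hp hS hfree
  obtain ⟨a, ha⟩ := hSd.exists_eq_image_range_card hd (by omega)
  have hmem : ∀ x, x ∈ (S : Set (ZMod p)) ↔ ∃ i ≤ m, x = a + (i : ℕ) * d := by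
    intro x
    rw [hS] at ha
    simp [ha, eq_comm]
  obtain ⟨j, hj, hja⟩ :=
    exists_sub_mul_eq_of_klFree hp hd (fun i hi => (hmem _).2 ⟨i, hi, rfl⟩) hfree
  by_cases hj2 : j < (lam + 2) / 2
  · exact ⟨d⁻¹, j, inv_ne_zero hd, hj2, inv_smul_eq_ival_ajElt hlk (by omega) hd hmem hja⟩
  · have hmem' : ∀ x, x ∈ (S : Set (ZMod p)) ↔ ∃ i ≤ m, x = (a + m * d) + (i : ℕ) * (-d) := by
      intro x
      rw [hmem]
      constructor <;> rintro ⟨i, hi, rfl⟩ <;> refine ⟨m - i, by omega, ?_⟩ <;>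
        rw [Nat.cast_sub hi] <;> ring
    have hp0 : (((k + l) * m + 2 + lam : ℕ) : ZMod p) = 0 := by
      rw [← hp]
      exact ZMod.natCast_self p
    have hmd : (a + m * d) * (-d)⁻¹ = -(a * d⁻¹) - m := by
      field_simp
      ring
    refine ⟨(-d)⁻¹, lam - j, inv_ne_zero (neg_ne_zero.2 hd), by omega,
      inv_smul_eq_ival_ajElt hlk (by omega) (neg_ne_zero.2 hd) hmem' ?_⟩
    rw [hmd]
    push_cast [Nat.cast_sub hj] at hja hp0 ⊢
    linear_combination hp0 - hja
end

section
/- Let p be a prime, k, ℓ ≥ 1 integers, n ≥ 2, and let E_1, ..., E_k, F_1, ..., F_ℓ be nonempty subsets of F_p^n such that (E_1 + ... + E_k) ∩ (F_1 + ... + F_ℓ) = ∅. Then Σ_{i=1}^k |E_i| + Σ_{j=1}^ℓ |F_j| ≤ p^n + (k+ℓ−2)·p^{n−1}. Moreover, if Σ_{i=1}^k |E_i| + Σ_{j=1}^ℓ |F_j| > p^n + (k+ℓ−2)·p^{n−2}, then there exists a decomposition (v, K) of F_p^n such that, writing X* = Supp(X) ⊆ F_p (with respect to (v,K)) for each X ∈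 {E_1,...,E_k, F_1,...,F_ℓ}, one has (E_1* + ... + E_k*) ∩ (F_1* + ... + F_ℓ*) = ∅ and p+1 ≤ Σ_{i=1}^k |E_i*| + Σ_{j=1}^ℓ |F_j*| ≤ p + k + ℓ − 2. -/
open Pointwise

/-- `S` is a union of cosets of `H`. -/
def Periodic {G : Type*} [AddCommGroup G] (H : AddSubgroup G) (S : Set G) : Prop :=
  ∀ h ∈ H, ∀ x ∈ S, x + h ∈ S

section Kneser

variable {G : Type*} [AddCommGroup G]

lemma Periodic.add_mem_iff {H : AddSubgroup G} {S : Set G} (hS : Periodic H S) {h x : G}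
    (hh : h ∈ H) : x + h ∈ S ↔ x ∈ S :=
  ⟨fun hx => by simpa using hS (-h) (H.neg_mem hh) _ hx, hS h hh x⟩

lemma Periodic.sup {H₁ H₂ : AddSubgroup G} {S : Set G} (h₁ : Periodic H₁ S)
    (h₂ : Periodic H₂ S) : Periodic (H₁ ⊔ H₂) S := by
  intro h hh x hx
  obtain ⟨a, ha, b, hb, rfl⟩ := AddSubgroup.mem_sup.1 hh
  rw [← add_assoc]
  exact h₂ b hb _ (h₁ a ha x hx)

lemma Periodic.mono {H₁ H₂ : AddSubgroup G} {S : Set G} (h₂ : Periodic H₂ S)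
    (h : H₁ ≤ H₂) : Periodic H₁ S :=
  fun a ha => h₂ a (h ha)

lemma Periodic.union {H : AddSubgroup G} {S T : Set G} (hS : Periodic H S)
    (hT : Periodic H T) : Periodic H (S ∪ T) :=
  fun h hh x hx => hx.imp (hS h hh x) (hT h hh x)

lemma Periodic.inter {H : AddSubgroup G} {S T : Set G} (hS : Periodic H S)
    (hT : Periodic H T) : Periodic H (S ∩ T) :=
  fun h hh x hx => ⟨hS h hh x hx.1, hT h hh x hx.2⟩

lemma Periodic.compl {H : AddSubgroup G} {S : Set G} (hS : Periodic H S) : Periodic H Sᶜ :=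
  fun _ hh _ hx hx' => hx ((hS.add_mem_iff hh).1 hx')

lemma Periodic.add_right {H : AddSubgroup G} {S : Set G} (hS : Periodic H S) (T : Set G) :
    Periodic H (S + T) := by
  rintro h hh _ ⟨a, ha, b, hb, rfl⟩
  exact ⟨a + h, hS h hh a ha, b, hb, by simp only; abel⟩

lemma Periodic.neg {H : AddSubgroup G} {S : Set G} (hS : Periodic H S) : Periodic H (-S) := by
  intro h hh x hx
  have := hS (-h) (H.neg_mem hh) (-x) hx
  rwa [← neg_add] at this

lemma periodic_coset (H : AddSubgroup G) (x : G) : Periodic H {y | y - x ∈ H} := by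
  intro h hh y hy
  have := H.add_mem hy hh
  rwa [sub_add_eq_add_sub] at this

lemma Periodic.card_le [Finite G] {H : AddSubgroup G} {S : Set G} (hS : Periodic H S)
    (hne : S.Nonempty) : Nat.card H ≤ S.ncard := by
  obtain ⟨x, hx⟩ := hne
  rw [← Nat.card_coe_set_eq]
  exact Nat.card_le_card_of_injective (fun h : H => (⟨x + h, hS h h.2 x hx⟩ : S))
    fun a b hab => by simpa using hab

/-- Sets periodic under `H₁` and `H₂` respectively, inside a common coset of a subgroup
`L ≤ H₁ ⊔ H₂`, are independent with respect to the uniform distribution on that coset. -/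
lemma card_mul_ncard_inter [Finite G] {H₁ H₂ L : AddSubgroup G} {P Q : Set G} (x : G)
    (hL : L ≤ H₁ ⊔ H₂) (hP : Periodic H₁ P) (hQ : Periodic H₂ Q)
    (hPL : ∀ y ∈ P, y - x ∈ L) (hQL : ∀ y ∈ Q, y - x ∈ L) :
    Nat.card L * (P ∩ Q : Set G).ncard = P.ncard * Q.ncard := by
  rw [← Set.ncard_prod, ← Nat.card_coe_set_eq, ← Nat.card_coe_set_eq, ← Nat.card_prod]
  have key : ∀ g ∈ L, ∃ a ∈ H₁, ∃ b ∈ H₂, a + b = g :=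
    fun g hg => AddSubgroup.mem_sup.1 (hL hg)
  choose! a ha b hb hab using key
  refine Nat.card_congr
    { toFun := fun z => ⟨(z.2.1 + a z.1.1, z.2.1 - b z.1.1),
        hP _ (ha _ z.1.2) _ z.2.2.1, ?_⟩
      invFun := fun w => (⟨w.1.1 - w.1.2, ?_⟩,
        ⟨w.1.1 - a (w.1.1 - w.1.2), ?_, ?_⟩)
      left_inv := ?_
      right_inv := ?_ }
  · rw [sub_eq_add_neg]
    exact hQ _ (H₂.neg_mem (hb _ z.1.2)) _ z.2.2.2
  · simpa using L.sub_mem (hPL _ w.2.1) (hQL _ w.2.2)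
  · have h : w.1.1 - w.1.2 ∈ L := by simpa using L.sub_mem (hPL _ w.2.1) (hQL _ w.2.2)
    rw [sub_eq_add_neg]
    exact hP _ (H₁.neg_mem (ha _ h)) _ w.2.1
  · have h : w.1.1 - w.1.2 ∈ L := by simpa using L.sub_mem (hPL _ w.2.1) (hQL _ w.2.2)
    have h' := hQ _ (hb _ h) _ w.2.2
    convert h' using 1
    rw [eq_sub_of_add_eq' (hab _ h)]
    abel
  · rintro ⟨⟨g, hg⟩, ⟨y, hy⟩⟩
    have h : y + a g - (y - b g) = g := by rw [add_sub_sub_cancel, hab g hg]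
    simp [h]
  · rintro ⟨⟨y, z⟩, hy, hz⟩
    have h : y - z ∈ L := by simpa using L.sub_mem (hPL _ hy) (hQL _ hz)
    have h' := hab _ h
    ext
    · simp
    · simp only
      rw [sub_sub, h', sub_sub_cancel]

lemma card_sup_mul_card_inf [Finite G] (H₁ H₂ : AddSubgroup G) :
    Nat.card (H₁ ⊔ H₂ : AddSubgroup G) * Nat.card (H₁ ⊓ H₂ : AddSubgroup G) =
      Nat.card H₁ * Nat.card H₂ := by
  have := card_mul_ncard_inter (P := H₁) (Q := H₂) 0 le_rfl
    (fun h hh x hx => H₁.add_mem hx hh) (fun h hh x hx => H₂.add_mem hx hh)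
    (fun y hy => by simpa using (le_sup_left : H₁ ≤ H₁ ⊔ H₂) hy)
    (fun y hy => by simpa using (le_sup_right : H₂ ≤ H₁ ⊔ H₂) hy)
  rw [← Nat.card_coe_set_eq, ← Nat.card_coe_set_eq, ← Nat.card_coe_set_eq] at this
  exact this

/-- If `|P|, |P'|` are `a, a'` and `|Q'|, |Q|` are `b, b'`, the cardinalities `c = |P ∩ Q|` and
`c' = |P' ∩ Q'|` cannot both be small. -/
lemma grid_inequality {a a' b b' c c' L h h₁ h₂ : ℕ} (ha : a + a' = L) (hb : b + b' = L)
    (hc : L * c = a * b') (hc' : L * c' = a' * b) (hL : L * h = h₁ * h₂) (h₂₁ : h₂ ≤ h₁)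
    (ha₁ : h₁ ≤ a) (hb₂ : h₂ ≤ b') (ha' : a' = 0 ∨ h₁ ≤ a') (hb' : b = 0 ∨ h₂ ≤ b)
    (hpos : 0 < L) : h₂ ≤ c + h ∨ h₁ ≤ c' + h := by
  by_contra! hcon
  obtain ⟨k₁, k₂⟩ := hcon
  have k₁ : a * b' + h₁ * h₂ < L * h₂ := by nlinarith
  have k₂ : a' * b + h₁ * h₂ < L * h₁ := by nlinarith
  rcases ha' with rfl | ha'
  · obtain rfl : a = L := by simpa using ha
    nlinarith
  rcases hb' with rfl | hb'
  · obtain rfl : b' = L := by simpa using hb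
    nlinarith
  zify at *
  have e₁ : (a : ℤ) * (b' - h₂) < h₂ * (a' - h₁) := by rw [← ha] at k₁; linarith
  have e₂ : (b : ℤ) * (a' - h₁) < h₁ * (b' - h₂) := by rw [← hb] at k₂; linarith
  nlinarith [mul_nonneg (sub_nonneg.2 ha₁) (sub_nonneg.2 hb₂),
    mul_nonneg (sub_nonneg.2 hb') (sub_nonneg.2 ha')]

lemma exists_periodic_union_of_card_le [Finite G] {C₁ C₂ : Set G} {H₁ H₂ : AddSubgroup G}
    {t : ℕ} (hC₁ : Periodic H₁ C₁) (hC₂ : Periodic H₂ C₂) (ht₁ : t ≤ C₁.ncard + Nat.card H₁)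
    (ht₂ : t ≤ C₂.ncard + Nat.card H₂) (hle : Nat.card H₂ ≤ Nat.card H₁) :
    ∃ H : AddSubgroup G, Periodic H (C₁ ∪ C₂) ∧ t ≤ (C₁ ∪ C₂).ncard + Nat.card H := by
  by_cases hsub : C₁ ⊆ C₂
  · exact ⟨H₂, by rwa [Set.union_eq_right.2 hsub], by rwa [Set.union_eq_right.2 hsub]⟩
  obtain ⟨x, hx₁, hx₂⟩ := Set.not_subset.1 hsub
  refine ⟨H₁ ⊓ H₂, (hC₁.mono inf_le_left).union (hC₂.mono inf_le_right), ?_⟩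
  let L := H₁ ⊔ H₂
  let D : Set G := {y | y - x ∈ L}
  have hxD : x ∈ D := by simp [D]
  have hD₁ : Periodic H₁ D := (periodic_coset L x).mono le_sup_left
  have hD₂ : Periodic H₂ D := (periodic_coset L x).mono le_sup_right
  have hDcard : D.ncard = Nat.card L := by
    rw [← Nat.card_coe_set_eq]
    exact Nat.card_congr ((Equiv.subRight x).subtypeEquiv fun y => Iff.rfl)
  have split (C : Set G) : (C ∩ D).ncard + (Cᶜ ∩ D).ncard = Nat.card L := by
    rw [← hDcard, Set.inter_comm C, Set.inter_comm Cᶜ, ← Set.sdiff_eq]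
    exact Set.ncard_inter_add_ncard_sdiff_eq_ncard D C
  have indep {P Q : Set G} (hP : Periodic H₁ P) (hQ : Periodic H₂ Q) :
      Nat.card L * ((P ∩ D) ∩ (Q ∩ D)).ncard = (P ∩ D).ncard * (Q ∩ D).ncard :=
    card_mul_ncard_inter x le_rfl (hP.inter hD₁) (hQ.inter hD₂)
      (fun y hy => hy.2) (fun y hy => hy.2)
  have dich {H : AddSubgroup G} {P : Set G} (hP : Periodic H P) :
      P.ncard = 0 ∨ Nat.card H ≤ P.ncard := by
    rcases P.eq_empty_or_nonempty with rfl | hne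
    · simp
    · exact .inr (hP.card_le hne)
  have diff₁ : ((C₁ ∩ D) ∩ (C₂ᶜ ∩ D)).ncard ≤ (C₁ \ C₂).ncard :=
    Set.ncard_le_ncard fun y hy => ⟨hy.1.1, hy.2.1⟩
  have diff₂ : ((C₁ᶜ ∩ D) ∩ (C₂ ∩ D)).ncard ≤ (C₂ \ C₁).ncard :=
    Set.ncard_le_ncard fun y hy => ⟨hy.2.1, hy.1.1⟩
  have union₁ : (C₁ \ C₂).ncard + C₂.ncard = (C₁ ∪ C₂).ncard :=
    Set.ncard_sdiff_add_ncard C₁ C₂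
  have union₂ : (C₂ \ C₁).ncard + C₁.ncard = (C₁ ∪ C₂).ncard := by
    rw [Set.union_comm]
    exact Set.ncard_sdiff_add_ncard C₂ C₁
  have := grid_inequality (split C₁) (split C₂) (indep hC₁ hC₂.compl) (indep hC₁.compl hC₂)
    (card_sup_mul_card_inf H₁ H₂) hle ((hC₁.inter hD₁).card_le ⟨x, hx₁, hxD⟩)
    ((hC₂.compl.inter hD₂).card_le ⟨x, hx₂, hxD⟩) (dich (hC₁.compl.inter hD₁))
    (dich (hC₂.inter hD₂)) Nat.card_pos
  omega

lemma exists_periodic_union [Finite G] {C₁ C₂ : Set G} {H₁ H₂ : AddSubgroup G}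
    {t : ℕ} (hC₁ : Periodic H₁ C₁) (hC₂ : Periodic H₂ C₂) (ht₁ : t ≤ C₁.ncard + Nat.card H₁)
    (ht₂ : t ≤ C₂.ncard + Nat.card H₂) :
    ∃ H : AddSubgroup G, Periodic H (C₁ ∪ C₂) ∧ t ≤ (C₁ ∪ C₂).ncard + Nat.card H := by
  rcases le_total (Nat.card H₂) (Nat.card H₁) with h | h
  · exact exists_periodic_union_of_card_le hC₁ hC₂ ht₁ ht₂ h
  · rw [Set.union_comm]
    exact exists_periodic_union_of_card_le hC₂ hC₁ ht₂ ht₁ h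

/-- Iterating the Dyson transform produces a large periodic subset of `A + B` through any
prescribed point. -/
lemma exists_periodic_subset_add [Finite G] (N : ℕ) :
    ∀ A B : Set G, B.ncard ≤ N → ∀ a ∈ A, ∀ b ∈ B,
      ∃ (C : Set G) (H : AddSubgroup G), a + b ∈ C ∧ C ⊆ A + B ∧ Periodic H C ∧
        A.ncard + B.ncard ≤ C.ncard + Nat.card H := by
  induction N with
  | zero =>
    intro A B hB a _ b hb
    rw [Nat.le_zero, Set.ncard_eq_zero] at hB
    simp [hB] at hb
  | succ N ih =>
    intro A B hB a ha b hb
    by_cases hAB : ∀ e ∈ A, ∀ y ∈ B, e - b + y ∈ A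
    · let H := AddSubgroup.closure ((fun y => y - b) '' B)
      have hsub : Periodic H A := by
        have hstab : ∀ z ∈ (fun y => y - b) '' B, ∀ e ∈ A, e + z ∈ A := by
          rintro _ ⟨y, hy, rfl⟩ e he
          convert hAB e he y hy using 1
          simp only
          abel
        intro h hh
        induction hh using AddSubgroup.closure_induction with
        | mem z hz => exact hstab z hz
        | zero => simp
        | add u w _ _ hu hw =>
          intro e he
          rw [← add_assoc]
          exact hw _ (hu e he)
        | neg u _ hu =>
          have himg : (fun e => e + u) '' A = A :=
            Set.eq_of_subset_of_ncard_le (by rintro _ ⟨e, he, rfl⟩; exact hu e he)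
              (Set.ncard_image_of_injective _ (add_left_injective u)).ge
          intro e he
          rw [← himg] at he
          obtain ⟨e', he', rfl⟩ := he
          simpa using he'
      refine ⟨(fun e => e + b) '' A, H, ⟨a, ha, rfl⟩, ?_, ?_, ?_⟩
      · rintro _ ⟨e, he, rfl⟩
        exact Set.add_mem_add he hb
      · rintro h hh _ ⟨e, he, rfl⟩
        exact ⟨e + h, hsub h hh e he, by simp only; abel⟩
      · rw [Set.ncard_image_of_injective _ (add_left_injective b),
          ← Set.ncard_image_of_injective B (sub_left_injective (b := b))]
        have : ((fun y => y - b) '' B).ncard ≤ (H : Set G).ncard :=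
          Set.ncard_le_ncard AddSubgroup.subset_closure
        rw [← Nat.card_coe_set_eq (H : Set G)] at this
        exact Nat.add_le_add_left this _
    · push Not at hAB
      obtain ⟨e, he, y, hy, hey⟩ := hAB
      let B₁ : Set G := (fun y => e - b + y) '' B
      have hinj : Function.Injective fun y => e - b + y := add_right_injective _
      let B' : Set G := {y ∈ B | e - b + y ∈ A}
      have himg : (fun y => e - b + y) '' B' = A ∩ B₁ := by
        ext z
        constructor
        · rintro ⟨w, hw, rfl⟩
          exact ⟨hw.2, w, hw.1, rfl⟩
        · rintro ⟨hz, w, hw, rfl⟩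
          exact ⟨w, ⟨hw, hz⟩, rfl⟩
      have hlt : B'.ncard < B.ncard :=
        Set.ncard_lt_ncard ⟨fun z hz => hz.1, fun h => hey (h hy).2⟩
      obtain ⟨C, H, hC, hCsub, hper, hcard⟩ := ih (A ∪ B₁) B' (by omega) a (.inl ha) b
        ⟨hb, by simpa using he⟩
      refine ⟨C, H, hC, hCsub.trans ?_, hper, ?_⟩
      · rintro _ ⟨u, hu | ⟨w, hw, rfl⟩, z, hz, rfl⟩
        · exact ⟨u, hu, z, hz.1, rfl⟩
        · exact ⟨e - b + z, hz.2, w, hw, by simp only; abel⟩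
      · have h₁ := Set.ncard_union_add_ncard_inter A B₁
        rw [← himg, Set.ncard_image_of_injective _ hinj,
          Set.ncard_image_of_injective _ hinj] at h₁
        omega

/-- **Kneser's theorem** for two summands. -/
theorem kneser [Finite G] {A B : Set G} (hA : A.Nonempty) (hB : B.Nonempty) :
    ∃ H : AddSubgroup G, Periodic H (A + B) ∧
      A.ncard + B.ncard ≤ (A + B).ncard + Nat.card H := by
  have key : ∀ s : Set G, s.Finite → s.Nonempty → s ⊆ A + B →
      ∃ (C : Set G) (H : AddSubgroup G), s ⊆ C ∧ C ⊆ A + B ∧ Periodic H C ∧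
        A.ncard + B.ncard ≤ C.ncard + Nat.card H := by
    intro s hs
    induction s, hs using Set.Finite.induction_on with
    | empty => simp
    | @insert c s _ _ ih =>
      intro _ hsub
      obtain ⟨hc, hsub'⟩ := Set.insert_subset_iff.1 hsub
      obtain ⟨a, ha, b, hb, rfl⟩ := hc
      obtain ⟨C₁, H₁, h₁, hC₁, hper₁, hcard₁⟩ :=
        exists_periodic_subset_add B.ncard A B le_rfl a ha b hb
      rcases s.eq_empty_or_nonempty with rfl | hne
      · exact ⟨C₁, H₁, by simpa using h₁, hC₁, hper₁, hcard₁⟩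
      obtain ⟨C₂, H₂, h₂, hC₂, hper₂, hcard₂⟩ := ih hne hsub'
      obtain ⟨H, hper, hcard⟩ := exists_periodic_union hper₁ hper₂ hcard₁ hcard₂
      exact ⟨C₁ ∪ C₂, H, Set.insert_subset (.inl h₁) (h₂.trans Set.subset_union_right),
        Set.union_subset hC₁ hC₂, hper, hcard⟩
  obtain ⟨C, H, h₁, h₂, hper, hcard⟩ := key (A + B) (Set.toFinite _) (hA.add hB) le_rfl
  obtain rfl := h₂.antisymm h₁
  exact ⟨H, hper, hcard⟩

lemma Set.Nonempty.finset_sum {ι : Type*} {s : Finset ι} {A : ι → Set G}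
    (hA : ∀ i ∈ s, (A i).Nonempty) : (∑ i ∈ s, A i).Nonempty := by
  choose! a ha using hA
  exact ⟨_, Set.finsetSum_mem_finsetSum s A a ha⟩

/-- **Kneser's theorem** for finitely many summands. -/
theorem kneser_sum [Finite G] {ι : Type*} {s : Finset ι} (hs : s.Nonempty) {A : ι → Set G}
    (hA : ∀ i ∈ s, (A i).Nonempty) :
    ∃ H : AddSubgroup G, Periodic H (∑ i ∈ s, A i) ∧
      ∑ i ∈ s, (A i).ncard ≤ (∑ i ∈ s, A i).ncard + (s.card - 1) * Nat.card H := by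
  induction hs using Finset.Nonempty.cons_induction with
  | singleton i => exact ⟨⊥, by simp [Periodic], by simp⟩
  | cons i s hi hs ih =>
    obtain ⟨H₁, hper₁, hcard₁⟩ := ih fun j hj => hA j (Finset.mem_cons_of_mem hj)
    obtain ⟨H₂, hper₂, hcard₂⟩ := kneser (hA i (Finset.mem_cons_self i s))
      (Set.Nonempty.finset_sum fun j hj => hA j (Finset.mem_cons_of_mem hj))
    rw [Finset.sum_cons, Finset.sum_cons, Finset.card_cons, Nat.add_sub_cancel]
    refine ⟨H₁ ⊔ H₂, ?_, ?_⟩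
    · rw [add_comm] at hper₂ ⊢
      exact (hper₁.add_right _).sup hper₂
    · have hle₁ : Nat.card H₁ ≤ Nat.card (H₁ ⊔ H₂ : AddSubgroup G) :=
        AddSubgroup.card_le_of_le le_sup_left
      have hle₂ : Nat.card H₂ ≤ Nat.card (H₁ ⊔ H₂ : AddSubgroup G) :=
        AddSubgroup.card_le_of_le le_sup_right
      have hmul := Nat.mul_le_mul_left (s.card - 1) hle₁
      obtain ⟨m, hm⟩ := Nat.exists_eq_add_one.2 hs.card_pos
      rw [hm] at hcard₁ hmul ⊢
      rw [Nat.add_sub_cancel] at hcard₁ hmul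
      rw [add_mul]
      omega

/-- If two sumsets are disjoint, Kneser's theorem bounds the total size of their summands. -/
theorem exists_periodic_of_disjoint_sums [Finite G] {k l : ℕ} (hk : 1 ≤ k) (hl : 1 ≤ l)
    {E : Fin k → Set G} {F : Fin l → Set G} (hE : ∀ i, (E i).Nonempty)
    (hF : ∀ j, (F j).Nonempty) (hdisj : (∑ i, E i) ∩ (∑ j, F j) = ∅) :
    ∃ H : AddSubgroup G, H ≠ ⊤ ∧ (∀ s ∈ ∑ i, E i, ∀ t ∈ ∑ j, F j, s - t ∉ H) ∧
      (∑ i, (E i).ncard) + (∑ j, (F j).ncard) ≤ Nat.card G + (k + l - 2) * Nat.card H := by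
  have hneE : (∑ i, E i).Nonempty := Set.Nonempty.finset_sum fun i _ => hE i
  have hneF : (∑ j, F j).Nonempty := Set.Nonempty.finset_sum fun j _ => hF j
  obtain ⟨H₁, hper₁, hcard₁⟩ := kneser_sum (s := Finset.univ) ⟨⟨0, hk⟩, Finset.mem_univ _⟩
    fun i _ => hE i
  obtain ⟨H₂, hper₂, hcard₂⟩ := kneser_sum (s := Finset.univ) ⟨⟨0, hl⟩, Finset.mem_univ _⟩
    fun j _ => hF j
  rw [Finset.card_univ, Fintype.card_fin] at hcard₁ hcard₂
  generalize ∑ i, E i = S at *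
  generalize ∑ j, F j = T at *
  obtain ⟨H₃, hper₃, hcard₃⟩ := kneser hneE hneF.neg
  let H := H₁ ⊔ H₂ ⊔ H₃
  have hper : Periodic H (S + -T) := by
    refine ((hper₁.add_right _).sup ?_).sup hper₃
    rw [add_comm]
    exact hper₂.neg.add_right S
  have hnot : ∀ h ∈ H, h ∉ S + -T := by
    intro h hh hmem
    have := hper (-h) (H.neg_mem hh) h hmem
    rw [add_neg_cancel] at this
    obtain ⟨s, hs, t, ht, hst⟩ := this
    have hst : s = -t := eq_neg_of_add_eq_zero_left hst
    exact Set.eq_empty_iff_forall_notMem.1 hdisj s ⟨hs, hst ▸ ht⟩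
  have hsub : ∀ s ∈ S, ∀ t ∈ T, s - t ∉ H := by
    intro s hs t ht hst
    refine hnot _ hst ?_
    rw [sub_eq_add_neg]
    exact Set.add_mem_add hs (Set.neg_mem_neg.2 ht)
  refine ⟨H, ?_, hsub, ?_⟩
  · rintro hH
    obtain ⟨s, hs⟩ := hneE
    obtain ⟨t, ht⟩ := hneF
    exact hsub s hs t ht (hH ▸ AddSubgroup.mem_top _)
  · have hle₁ : Nat.card H₁ ≤ Nat.card H :=
      AddSubgroup.card_le_of_le (le_sup_left.trans le_sup_left)
    have hle₂ : Nat.card H₂ ≤ Nat.card H :=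
      AddSubgroup.card_le_of_le (le_sup_right.trans le_sup_left)
    have hle₃ : Nat.card H₃ ≤ Nat.card H := AddSubgroup.card_le_of_le le_sup_right
    have hcompl : (S + -T).ncard + Nat.card H ≤ Nat.card G := by
      rw [← Set.ncard_add_ncard_compl (S + -T)]
      gcongr
      exact (Nat.card_coe_set_eq (H : Set G)).trans_le (Set.ncard_le_ncard hnot)
    rw [Set.ncard_neg] at hcard₃
    have hm₁ := Nat.mul_le_mul_left (k - 1) hle₁
    have hm₂ := Nat.mul_le_mul_left (l - 1) hle₂
    have hsplit : k + l - 2 = (k - 1) + (l - 1) := by omega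
    rw [hsplit, add_mul]
    omega

end Kneser

section Support

variable {p n : ℕ} {v : Fin n → ZMod p} {K : Submodule (ZMod p) (Fin n → ZMod p)}

lemma supp_nonempty {A : Set (Fin n → ZMod p)} (hvK : ∀ y, ∃ i : ZMod p, y - i • v ∈ K)
    (hA : A.Nonempty) : (supp v K A).Nonempty := by
  obtain ⟨y, hy⟩ := hA
  obtain ⟨i, hi⟩ := hvK y
  exact ⟨i, y - i • v, hi, by simpa using hy⟩

lemma ncard_le_ncard_supp_mul [NeZero p] (A : Set (Fin n → ZMod p))
    (hvK : ∀ y, ∃ i : ZMod p, y - i • v ∈ K) :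
    A.ncard ≤ (supp v K A).ncard * Nat.card K := by
  have hcard : Nat.card K = (K : Set (Fin n → ZMod p)).ncard := Nat.card_coe_set_eq _
  rw [hcard, ← Set.ncard_prod]
  refine (Set.ncard_le_ncard (t := (fun z : ZMod p × (Fin n → ZMod p) => z.2 + z.1 • v) ''
    (supp v K A ×ˢ (K : Set (Fin n → ZMod p)))) ?_).trans (Set.ncard_image_le)
  intro y hy
  obtain ⟨i, hi⟩ := hvK y
  exact ⟨(i, y - i • v), ⟨⟨y - i • v, hi, by simpa using hy⟩, hi⟩, by simp⟩

lemma exists_mem_sum_of_mem_sum_supp {m : ℕ} {A : Fin m → Set (Fin n → ZMod p)} {i : ZMod p}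
    (hi : i ∈ ∑ j, supp v K (A j)) : ∃ x ∈ K, x + i • v ∈ ∑ j, A j := by
  obtain ⟨g, hg, rfl⟩ := (Set.mem_fintype_sum _ _).1 hi
  choose x hxK hxA using hg
  refine ⟨∑ j, x j, K.sum_mem fun j _ => hxK j, ?_⟩
  rw [Finset.sum_smul, ← Finset.sum_add_distrib]
  exact Set.finsetSum_mem_finsetSum _ _ _ fun j _ => hxA j

lemma exists_sub_smul_mem [Fact p.Prime] (hn : 1 ≤ n)
    (hK : Module.finrank (ZMod p) K = n - 1) (hv : v ∉ K) (y : Fin n → ZMod p) :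
    ∃ i : ZMod p, y - i • v ∈ K := by
  have hinj : Function.Injective fun z : ZMod p × K => (z.2 : Fin n → ZMod p) + z.1 • v := by
    rintro ⟨i, x⟩ ⟨j, z⟩ h
    simp only at h
    have hmem : (i - j) • v ∈ K := by
      have : (i - j) • v = z - x := by
        rw [sub_smul, sub_eq_sub_iff_add_eq_add, add_comm, h]
      rw [this]
      exact K.sub_mem z.2 x.2
    have hij : i = j := by
      by_contra hne
      exact hv ((K.smul_mem_iff (sub_ne_zero.2 hne)).1 hmem)
    subst hij
    simpa using h
  have hcard : Nat.card (Fin n → ZMod p) ≤ Nat.card (ZMod p × K) := by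
    rw [Nat.card_prod, Module.natCard_eq_pow_finrank (K := ZMod p) (V := K), hK, Nat.card_zmod,
      ← pow_succ', Nat.sub_add_cancel hn]
    simp
  obtain ⟨⟨i, x⟩, rfl⟩ := (hinj.bijective_of_nat_card_le hcard).2 y
  exact ⟨i, by simp⟩

end Support

/-- If `(E₁+⋯+E_k) ∩ (F₁+⋯+F_ℓ) = ∅` for nonempty subsets of `F_p^n`,
then `Σ|E_i| + Σ|F_j| ≤ p^n + (k+ℓ-2)p^(n-1)`; and if `Σ|E_i| + Σ|F_j| > p^n + (k+ℓ-2)p^(n-2)`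
then there is a decomposition whose supports satisfy the analogous disjointness and
`p+1 ≤ Σ|E_i*| + Σ|F_j*| ≤ p+k+ℓ-2`. -/
theorem stmt9 (p n k l : ℕ) (hp : p.Prime) (hn : 2 ≤ n) (hk : 1 ≤ k) (hl : 1 ≤ l)
    (E : Fin k → Set (Fin n → ZMod p)) (F : Fin l → Set (Fin n → ZMod p))
    (hE : ∀ i, (E i).Nonempty) (hF : ∀ j, (F j).Nonempty)
    (hdisj : (∑ i, E i) ∩ (∑ j, F j) = ∅) :
    (∑ i, (E i).ncard) + (∑ j, (F j).ncard) ≤ p ^ n + (k + l - 2) * p ^ (n - 1) ∧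
      (p ^ n + (k + l - 2) * p ^ (n - 2) < (∑ i, (E i).ncard) + (∑ j, (F j).ncard) →
        ∃ (v : Fin n → ZMod p) (K : Submodule (ZMod p) (Fin n → ZMod p)),
          Module.finrank (ZMod p) K = n - 1 ∧ v ∉ K ∧
          (∑ i, supp v K (E i)) ∩ (∑ j, supp v K (F j)) = ∅ ∧
          p + 1 ≤ (∑ i, (supp v K (E i)).ncard) + (∑ j, (supp v K (F j)).ncard) ∧
          (∑ i, (supp v K (E i)).ncard) + (∑ j, (supp v K (F j)).ncard) ≤ p + k + l - 2) := by
  have : Fact p.Prime := ⟨hp⟩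
  obtain ⟨H, hH, hsub, hle⟩ := exists_periodic_of_disjoint_sums hk hl hE hF hdisj
  let K : Submodule (ZMod p) (Fin n → ZMod p) := AddSubgroup.toZModSubmodule p H
  have hKtop : K ≠ ⊤ := by
    intro h
    refine hH (eq_top_iff.2 fun x _ => ?_)
    have : x ∈ K := h ▸ Submodule.mem_top
    exact this
  have hcardH : Nat.card H = p ^ Module.finrank (ZMod p) K := by
    have := Module.natCard_eq_pow_finrank (K := ZMod p) (V := K)
    rwa [Nat.card_zmod] at this
  have hrank : Module.finrank (ZMod p) K < n := by
    simpa using Submodule.finrank_lt hKtop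
  have hcardG : Nat.card (Fin n → ZMod p) = p ^ n := by simp
  rw [hcardH, hcardG] at hle
  refine ⟨hle.trans ?_, fun hlt => ?_⟩
  · gcongr
    · exact hp.one_le
    · omega
  have hK : Module.finrank (ZMod p) K = n - 1 := by
    by_contra hne
    refine absurd (hlt.trans_le hle) (not_lt.2 ?_)
    gcongr
    · exact hp.one_le
    · omega
  obtain ⟨v, hv⟩ : ∃ v, v ∉ K := by
    by_contra! h
    exact hKtop (eq_top_iff.2 fun x _ => h x)
  have hvK := exists_sub_smul_mem (by omega) hK hv
  have hdisj' : (∑ i, supp v K (E i)) ∩ (∑ j, supp v K (F j)) = ∅ := by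
    refine Set.eq_empty_iff_forall_notMem.2 fun i hi => ?_
    obtain ⟨x, hx, hxE⟩ := exists_mem_sum_of_mem_sum_supp hi.1
    obtain ⟨y, hy, hyF⟩ := exists_mem_sum_of_mem_sum_supp hi.2
    refine hsub _ hxE _ hyF ?_
    rw [add_sub_add_right_eq_sub]
    exact K.sub_mem hx hy
  refine ⟨v, K, hK, hv, hdisj', ?_, ?_⟩
  · have hsum : (∑ i, (E i).ncard) + (∑ j, (F j).ncard) ≤
        ((∑ i, (supp v K (E i)).ncard) + (∑ j, (supp v K (F j)).ncard)) * p ^ (n - 1) := by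
      rw [← hK, ← hcardH, add_mul, Finset.sum_mul, Finset.sum_mul]
      gcongr with i _ j _
      · exact ncard_le_ncard_supp_mul (E i) hvK
      · exact ncard_le_ncard_supp_mul (F j) hvK
    have hpow : p ^ n = p * p ^ (n - 1) := by rw [← pow_succ', Nat.sub_add_cancel (by omega)]
    exact Nat.succ_le_of_lt <| lt_of_mul_lt_mul_right
      (hpow ▸ ((Nat.le_add_right _ _).trans_lt hlt).trans_le hsum) (Nat.zero_le _)
  · obtain ⟨H', hH', -, hle'⟩ := exists_periodic_of_disjoint_sums hk hl
      (fun i => supp_nonempty hvK (hE i)) (fun j => supp_nonempty hvK (hF j)) hdisj'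
    have : Fact (Nat.card (ZMod p)).Prime := ⟨by rwa [Nat.card_zmod]⟩
    obtain rfl := H'.eq_bot_or_eq_top_of_prime_card.resolve_right hH'
    rw [Nat.card_zmod, AddSubgroup.card_bot, mul_one] at hle'
    omega
end

section
/- Let k > ℓ ≥ 1, p = (k+ℓ)m+2+λ prime with 0 ≤ λ ≤ k+ℓ−3, and n ≥ 2. Let A ⊆ F_p^n be (k,ℓ)-sum-free with |A| ≥ m·p^{n−1}. Fix a decomposition (v,K) of F_p^n and an enumeration b_1, ..., b_p of F_p with |A_{b_1}| ≥ ... ≥ |A_{b_p}|, and set C_m = {b_1, ..., b_m}. If k·|A_{b_m}| ≥ (p+k−1)·p^{n−2}, then the k-fold sumset kC_m and the ℓ-fold sumset ℓ·Supp(A) are disjoint: (kC_m) ∩ (ℓ Supp(A)) = ∅; in particular C_m is (k,ℓ)-sum-free. -/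
open Pointwise

open Finset in
/-- A weak form of Kneser's theorem: if every proper subgroup of `G` has at most `h` elements, then
`|A + B| ≥ |A| + |B| - h` unless `A + B = G`. -/
theorem add_eq_univ_or_card_add_card_le {G : Type*} [AddCommGroup G] [Fintype G] [DecidableEq G]
    {h : ℕ} (hh : ∀ H : AddSubgroup G, H ≠ ⊤ → Nat.card H ≤ h) (A B : Finset G)
    (hA : A.Nonempty) (hB : B.Nonempty) :
    A + B = univ ∨ #A + #B ≤ #(A + B) + h := by
  induction hc : #B using Nat.strong_induction_on generalizing A B with
  | _ N ih =>
  subst hc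
  by_cases hstab : ∀ a ∈ A, ∀ b ∈ B, ∀ c ∈ B, a - b + c ∈ A
  · obtain ⟨b, hb⟩ := hB
    let H : AddSubgroup G := AddSubgroup.closure {x | ∃ y ∈ B, ∃ z ∈ B, x = z - y}
    have hHA : ∀ x ∈ H, ∀ a ∈ A, a + x ∈ A := by
      intro x hx
      induction hx using AddSubgroup.closure_induction with
      | mem x hx =>
        obtain ⟨y, hy, z, hz, rfl⟩ := hx
        intro a ha
        simpa [sub_add_eq_add_sub, add_sub_assoc] using hstab a ha y hy z hz
      | zero => simp
      | add x y _ _ hx hy =>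
        intro a ha
        rw [← add_assoc]
        exact hy _ (hx a ha)
      | neg x _ hx =>
        intro a ha
        obtain ⟨c, hc, hca⟩ := Finset.surj_on_of_inj_on_of_card_le (s := A) (t := A)
          (fun a _ => a + x) hx (fun _ _ _ _ h => add_right_cancel h) le_rfl a ha
        simpa [hca] using hc
    by_cases hH : H = ⊤
    · left
      obtain ⟨a, ha⟩ := hA
      refine eq_univ_of_forall fun x => mem_add.2 ⟨x - b, ?_, b, hb, by simp⟩
      simpa using hHA (x - b - a) (by simp [hH]) a ha
    · right
      have hBH : #B ≤ Nat.card H := by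
        rw [← Finset.card_image_of_injective B (sub_left_injective (b := b)),
          ← Set.ncard_coe_finset]
        refine Set.ncard_le_ncard (t := (H : Set G)) ?_ (Set.toFinite _)
        intro x hx
        obtain ⟨c, hc, rfl⟩ := mem_image.1 (mem_coe.1 hx)
        exact AddSubgroup.subset_closure ⟨b, hb, c, hc, rfl⟩
      have := hh H hH
      have := card_le_card_add_right (s := A) ⟨b, hb⟩
      omega
  · push Not at hstab
    obtain ⟨a, ha, b, hb, c, hc, hac⟩ := hstab
    let T := addDysonETransform (a - b) (A, B)
    have hsub : T.1 + T.2 ⊆ A + B := addDysonETransform.subset (a - b) (A, B)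
    have hcard : #T.1 + #T.2 = #A + #B := addDysonETransform.card (a - b) (A, B)
    have hT₁ : T.1.Nonempty := ⟨a, mem_union_left _ ha⟩
    have hT₂ : T.2.Nonempty :=
      ⟨b, mem_inter.2 ⟨hb, mem_vadd_finset.2 ⟨a, ha, by simp⟩⟩⟩
    have hlt : #T.2 < #B := by
      refine card_lt_card (Finset.ssubset_iff_subset_ne.2 ⟨inter_subset_left, fun he => hac ?_⟩)
      have hcT : c ∈ T.2 := he ▸ hc
      obtain ⟨y, hy, hyc⟩ := mem_vadd_finset.1 (mem_inter.1 hcT).2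
      rw [← hyc]
      have : a - b + (-(a - b) + y) = y := by abel
      simpa only [vadd_eq_add, this] using hy
    rcases ih _ hlt T.1 T.2 hT₁ hT₂ rfl with h₁ | h₁
    · left
      exact univ_subset_iff.1 (h₁ ▸ hsub)
    · right
      have := card_le_card hsub
      omega

theorem itSum_mono {G : Type*} [AddCommMonoid G] {A B : Set G} (h : A ⊆ B) (j : ℕ) :
    itSum j A ⊆ itSum j B := by
  induction j with
  | zero => exact subset_rfl
  | succ j ih => exact Set.add_subset_add ih h

theorem layerKL_add_mem {p n : ℕ} {v : Fin n → ZMod p} {K : Submodule (ZMod p) (Fin n → ZMod p)}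
    {A B : Set (Fin n → ZMod p)} {i j : ZMod p} {x y : Fin n → ZMod p}
    (hx : x ∈ layerKL v K A i) (hy : y ∈ layerKL v K B j) :
    x + y ∈ layerKL v K (A + B) (i + j) :=
  ⟨K.add_mem hx.1 hy.1, x + i • v, hx.2, y + j • v, hy.2, by
    simp only [add_smul]; abel⟩

theorem layerKL_itSum_nonempty {p n : ℕ} {v : Fin n → ZMod p}
    {K : Submodule (ZMod p) (Fin n → ZMod p)} {A : Set (Fin n → ZMod p)} (j : ℕ) {s : ZMod p}
    (hs : s ∈ itSum j (supp v K A)) : (layerKL v K (itSum j A) s).Nonempty := by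
  induction j generalizing s with
  | zero =>
    obtain rfl : s = 0 := hs
    exact ⟨0, K.zero_mem, by simp [itSum]⟩
  | succ j ih =>
    obtain ⟨t, ht, c, hc, rfl⟩ := hs
    obtain ⟨x, hx⟩ := ih ht
    obtain ⟨y, hy⟩ := hc
    exact ⟨x + y, layerKL_add_mem hx hy⟩

/-- If every layer over `C` has at least `β` elements, then a layer of the `(j+1)`-fold sumset over
a point of `(j+1)C` is all of `K` or has at least `(j+1)β - jh` elements, where `h` bounds the
size of the proper subgroups of `K`. -/
theorem layerKL_itSum_eq_or_le {p n : ℕ} [NeZero p] {v : Fin n → ZMod p}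
    {K : Submodule (ZMod p) (Fin n → ZMod p)} {A : Set (Fin n → ZMod p)} {C : Set (ZMod p)}
    {h β : ℕ} (hh : ∀ H : AddSubgroup K, H ≠ ⊤ → Nat.card H ≤ h) (hβ : 0 < β)
    (hC : ∀ c ∈ C, β ≤ (layerKL v K A c).ncard) (j : ℕ) {s : ZMod p}
    (hs : s ∈ itSum (j + 1) C) :
    layerKL v K (itSum (j + 1) A) s = K ∨
      (j + 1) * β ≤ (layerKL v K (itSum (j + 1) A) s).ncard + j * h := by
  classical
  induction j generalizing s with
  | zero =>
    right
    have hs' : s ∈ C := by simpa [itSum] using hs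
    simpa [itSum] using hC s hs'
  | succ j ih =>
    obtain ⟨t, ht, c, hc, rfl⟩ := hs
    have hCs : C ⊆ supp v K A := fun c hc =>
      Set.nonempty_of_ncard_ne_zero (hβ.trans_le (hC c hc)).ne'
    let L (B : Set (Fin n → ZMod p)) (i : ZMod p) : Finset K :=
      {x | (x : Fin n → ZMod p) ∈ layerKL v K B i}
    have hL (B : Set (Fin n → ZMod p)) (i : ZMod p) :
        (Subtype.val '' (L B i : Set K)) = layerKL v K B i := by
      ext x
      constructor
      · rintro ⟨y, hy, rfl⟩
        simpa [L] using hy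
      · intro hx
        exact ⟨⟨x, hx.1⟩, by simpa [L] using hx, rfl⟩
    have hLcard (B : Set (Fin n → ZMod p)) (i : ZMod p) :
        (L B i).card = (layerKL v K B i).ncard := by
      rw [← hL, Set.ncard_image_of_injective _ Subtype.val_injective, Set.ncard_coe_finset]
    have hLuniv (B : Set (Fin n → ZMod p)) (i : ZMod p) (hu : L B i = Finset.univ) :
        layerKL v K B i = K := by
      rw [← hL, hu]
      simp
    have hne₁ : (L (itSum (j + 1) A) t).Nonempty := by
      rw [← Finset.coe_nonempty, ← Set.image_nonempty (f := Subtype.val), hL]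
      exact layerKL_itSum_nonempty _ (itSum_mono hCs _ ht)
    have hne₂ : (L A c).Nonempty := by
      rw [← Finset.card_pos, hLcard]
      exact hβ.trans_le (hC c hc)
    have hsub : L (itSum (j + 1) A) t + L A c ⊆ L (itSum (j + 1 + 1) A) (t + c) := by
      intro x hx
      obtain ⟨y, hy, z, hz, rfl⟩ := Finset.mem_add.1 hx
      have hy' : (y : Fin n → ZMod p) ∈ layerKL v K (itSum (j + 1) A) t := by simpa [L] using hy
      have hz' : (z : Fin n → ZMod p) ∈ layerKL v K A c := by simpa [L] using hz
      exact Finset.mem_filter.2 ⟨Finset.mem_univ _, layerKL_add_mem hy' hz'⟩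
    have hsum := add_eq_univ_or_card_add_card_le hh _ _ hne₁ hne₂
    rcases hsum with hu | hle
    · exact Or.inl (hLuniv _ _ (Finset.univ_subset_iff.1 (hu ▸ hsub)))
    rcases ih ht with hK | hle'
    · left
      refine hLuniv _ _ (Finset.univ_subset_iff.1 (subset_trans ?_ hsub))
      obtain ⟨z, hz⟩ := hne₂
      intro x _
      refine Finset.mem_add.2 ⟨x - z, ?_, z, hz, by simp⟩
      refine Finset.mem_filter.2 ⟨Finset.mem_univ _, ?_⟩
      rw [hK]
      exact (x - z).2
    · right
      have hcard := Finset.card_le_card hsub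
      rw [hLcard] at hcard
      rw [hLcard, hLcard] at hle
      have := hC c hc
      nlinarith

/-- A proper subgroup of a group of order `p ^ (d + 1)` has at most `p ^ d` elements. -/
theorem AddSubgroup.card_le_prime_pow_of_ne_top {G : Type*} [AddGroup G] {p d : ℕ}
    (hp : p.Prime) (hG : Nat.card G = p ^ (d + 1)) {H : AddSubgroup G} (hH : H ≠ ⊤) :
    Nat.card H ≤ p ^ d := by
  have : Finite G := Nat.finite_of_card_ne_zero (by rw [hG]; exact (pow_pos hp.pos _).ne')
  obtain ⟨r, hr, hcard⟩ := (Nat.dvd_prime_pow hp).1 (hG ▸ H.card_addSubgroup_dvd_card)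
  rw [hcard]
  refine Nat.pow_le_pow_right hp.pos ?_
  by_contra hlt
  obtain rfl : r = d + 1 := by omega
  exact hH (H.eq_top_of_card_eq (hcard.trans hG.symm))

/-- If `k·|A_{b_m}| ≥ (p+k-1)·p^(n-2)` then `kC_m ∩ ℓ·Supp(A) = ∅`;
in particular `C_m = {b_1, …, b_m}` is `(k,ℓ)`-sum-free. -/
theorem stmt10 (k l n m lam p : ℕ) (hlk : l < k) (hl : 1 ≤ l) (hn : 2 ≤ n) (hm : 1 ≤ m)
    (hlam : lam ≤ k + l - 3) (hp : p = (k + l) * m + 2 + lam) (hpp : p.Prime)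
    (A : Set (Fin n → ZMod p)) (hA : A.Nonempty) (hfree : KLFree k l A)
    (hcard : m * p ^ (n - 1) ≤ A.ncard)
    (v : Fin n → ZMod p) (K : Submodule (ZMod p) (Fin n → ZMod p))
    (hK : Module.finrank (ZMod p) K = n - 1) (hv : v ∉ K)
    (b : ℕ → ZMod p) (hb : Set.BijOn b (Set.Icc 1 p) Set.univ)
    (hmono : ∀ i j : ℕ, 1 ≤ i → i ≤ j → j ≤ p →
      (layerKL v K A (b j)).ncard ≤ (layerKL v K A (b i)).ncard)
    (hbeta : (p + k - 1) * p ^ (n - 2) ≤ k * (layerKL v K A (b m)).ncard) :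
    itSum k (b '' Set.Icc 1 m) ∩ itSum l (supp v K A) = ∅ ∧
      KLFree k l (b '' Set.Icc 1 m) := by
  have : Fact p.Prime := ⟨hpp⟩
  obtain ⟨d, rfl⟩ : ∃ d, n = d + 2 := ⟨n - 2, by omega⟩
  obtain ⟨j, rfl⟩ : ∃ j, k = j + 1 := ⟨k - 1, by omega⟩
  simp only [Nat.add_sub_cancel] at hbeta
  have hmp : m ≤ p := by
    rw [hp]
    nlinarith
  have hKcard : Nat.card K = p ^ (d + 1) := by
    rw [Module.natCard_eq_pow_finrank (K := ZMod p), hK, Nat.card_zmod]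
    rfl
  set β := (layerKL v K A (b m)).ncard with hβdef
  have hpd : 0 < p ^ d := pow_pos hpp.pos d
  have hbeta' : p ^ (d + 1) + j * p ^ d ≤ (j + 1) * β := by
    calc p ^ (d + 1) + j * p ^ d = (p + (j + 1) - 1) * p ^ d := by
          rw [← add_assoc, Nat.add_sub_cancel]; ring
      _ ≤ _ := hbeta
  have hβ : 0 < β := by
    rcases Nat.eq_zero_or_pos β with h0 | h0
    · rw [h0, pow_succ] at hbeta'
      have := Nat.mul_pos hpd hpp.pos
      omega
    · exact h0
  have hC : ∀ c ∈ b '' Set.Icc 1 m, β ≤ (layerKL v K A c).ncard := by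
    rintro _ ⟨i, hi, rfl⟩
    exact hmono i m hi.1 hi.2 hmp
  have hdisj : itSum (j + 1) (b '' Set.Icc 1 m) ∩ itSum l (supp v K A) = ∅ := by
    refine Set.eq_empty_of_forall_notMem fun s hs => ?_
    have hfull : layerKL v K (itSum (j + 1) A) s = K := by
      rcases layerKL_itSum_eq_or_le
        (fun H hH => AddSubgroup.card_le_prime_pow_of_ne_top hpp hKcard hH) hβ hC j hs.1 with h | h
      · exact h
      · refine Set.eq_of_subset_of_ncard_le (fun x hx => hx.1) ?_ (Set.toFinite _)
        have : (K : Set (Fin (d + 2) → ZMod p)).ncard = p ^ (d + 1) := hKcard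
        omega
    obtain ⟨x, hx⟩ := layerKL_itSum_nonempty l hs.2
    have hx' : x ∈ layerKL v K (itSum (j + 1) A) s := by
      rw [hfull]
      exact hx.1
    exact Set.eq_empty_iff_forall_notMem.1 hfree _ ⟨hx'.2, hx.2⟩
  refine ⟨hdisj, Set.subset_empty_iff.1 (hdisj ▸ Set.inter_subset_inter_right _ ?_)⟩
  exact itSum_mono
    (fun c hc => Set.nonempty_of_ncard_ne_zero (hβ.trans_le (hC c hc)).ne') l
end

section
/- Let k > ℓ ≥ 1, p = (k+ℓ)m+2+λ prime with 0 ≤ λ ≤ k+ℓ−3, and n ≥ 2. Let A ⊆ F_p^n be (k,ℓ)-sum-free. Fix a decomposition (v,K) and an enumeration b_1, ..., b_p of F_p with |A_{b_1}| ≥ ... ≥ |A_{b_p}|, set C_i = {b_1,...,b_i}, and let ω = ω(A). Suppose r_1, ..., r_k, s_1, ..., s_ℓ ∈ {1, ..., ω} (not necessarily distinct) satisfy at least one of: (1) (C_{r_1} + ... + C_{r_k}) ∩ (C_{s_1} + ... + C_{s_ℓ}) ≠ ∅, or (2) r_1 + ... + r_k + s_1 + ... + s_ℓ ≥ p + k +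 ℓ − 1. Then |A_{b_{r_1}}| + ... + |A_{b_{r_k}}| + |A_{b_{s_1}}| + ... + |A_{b_{s_ℓ}}| ≤ (p+k+ℓ−2)·p^{n−2}. -/
open Pointwise

/-- A weak form of Kneser's theorem: if `M` bounds the order of every proper subgroup, then
`|A| + |B| ≤ |A + B| + M` unless `A + B` is the whole group. -/
theorem ncard_add_ncard_le_ncard_add {G : Type*} [AddCommGroup G] [Finite G] {M : ℕ}
    (hM : ∀ H : AddSubgroup G, H ≠ ⊤ → Nat.card H ≤ M) {A B : Set G}
    (hA : A.Nonempty) (hB : B.Nonempty) (hAB : A + B ≠ Set.univ) :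
    A.ncard + B.ncard ≤ (A + B).ncard + M := by
  induction hc : B.ncard using Nat.strong_induction_on generalizing A B with
  | _ c ih =>
  subst hc
  by_cases h : ∀ a ∈ A, ∀ x ∈ B, ∀ y ∈ B, y - x + a ∈ A
  · obtain ⟨a, ha⟩ := hA
    obtain ⟨x, hx⟩ := hB
    have hmem : ∀ y ∈ B, y - x ∈ AddAction.stabilizer G A := fun y hy ↦
      (AddAction.mem_stabilizer_set' A.toFinite).2 fun a' ha' ↦ h a' ha' x hx y hy
    have hH : AddAction.stabilizer G A ≠ ⊤ := by
      intro htop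
      refine hAB (Set.eq_univ_of_forall fun g ↦ ?_)
      have hg : (g - x - a) ∈ AddAction.stabilizer G A := htop ▸ AddSubgroup.mem_top _
      have := (AddAction.mem_stabilizer_set' A.toFinite).1 hg ha
      exact ⟨_, this, x, hx, by simp⟩
    have hBM : B.ncard ≤ M := by
      refine le_trans ?_ (hM _ hH)
      rw [← Set.ncard_image_of_injective B (sub_left_injective (b := x))]
      refine Set.ncard_le_ncard ?_ (Set.toFinite _)
      rintro _ ⟨y, hy, rfl⟩
      exact hmem y hy
    have hAle : A.ncard ≤ (A + B).ncard := by
      rw [← Set.ncard_image_of_injective A (add_left_injective x)]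
      refine Set.ncard_le_ncard ?_ (Set.toFinite _)
      rintro _ ⟨y, hy, rfl⟩
      exact Set.add_mem_add hy hx
    omega
  · push Not at h
    obtain ⟨a, ha, x, hx, y, hy, hxy⟩ := h
    set e := a - x with he
    have hinj : Function.Injective (fun z : G ↦ z + e) := add_left_injective e
    set A' := A ∪ (fun z ↦ z + e) '' B with hA'
    set B' := B ∩ (fun z ↦ z + e) ⁻¹' A
    have himg : (fun z ↦ z + e) '' B' = A ∩ (fun z ↦ z + e) '' B := by
      rw [Set.image_inter_preimage, Set.inter_comm]
    have hcard : A'.ncard + B'.ncard = A.ncard + B.ncard := by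
      rw [← Set.ncard_image_of_injective B' hinj, himg, Set.ncard_union_add_ncard_inter,
        Set.ncard_image_of_injective B hinj]
    have hsub : A' + B' ⊆ A + B := by
      rintro _ ⟨u, hu | ⟨w, hw, rfl⟩, z, hz, rfl⟩
      · exact Set.add_mem_add hu hz.1
      · exact ⟨z + e, hz.2, w, hw, by simp only; abel⟩
    have hlt : B'.ncard < B.ncard := by
      refine Set.ncard_lt_ncard ⟨Set.inter_subset_left, fun hBB ↦ hxy ?_⟩ B.toFinite
      have : y + e ∈ A := (hBB hy).2
      rwa [he, ← add_sub_assoc, add_sub_right_comm] at this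
    have hB' : B'.Nonempty := ⟨x, hx, by simpa [he] using ha⟩
    have hne : A' + B' ≠ Set.univ := fun hu ↦ hAB (Set.univ_subset_iff.1 (hu ▸ hsub))
    have hle := Set.ncard_le_ncard hsub (Set.toFinite _)
    have := ih _ hlt (hA.mono Set.subset_union_left) hB' hne rfl
    rw [← hA'] at this
    omega

theorem sum_ncard_le_ncard_sum {G : Type*} [AddCommGroup G] [Finite G] {M : ℕ}
    (hM : ∀ H : AddSubgroup G, H ≠ ⊤ → Nat.card H ≤ M) {k : ℕ} {X : Fin (k + 1) → Set G}
    (hX : ∀ i, (X i).Nonempty) (hsum : ∑ i, X i ≠ Set.univ) :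
    ∑ i, (X i).ncard ≤ (∑ i, X i).ncard + k * M := by
  induction k with
  | zero => simp
  | succ k ih =>
    rw [Fin.sum_univ_castSucc] at hsum
    rw [Fin.sum_univ_castSucc, Fin.sum_univ_castSucc X]
    have hne : ∑ i : Fin (k + 1), X i.castSucc ≠ Set.univ := by
      intro hu
      rw [hu, Set.univ_add (hX _)] at hsum
      exact hsum rfl
    have h₁ := ih (fun i ↦ hX i.castSucc) hne
    have hS : (∑ i : Fin (k + 1), X i.castSucc).Nonempty := by
      choose f hf using hX
      exact ⟨_, Set.finsetSum_mem_finsetSum _ _ _ fun i _ ↦ hf i.castSucc⟩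
    have h₂ := ncard_add_ncard_le_ncard_add hM hS (hX (Fin.last (k + 1))) hsum
    linarith

theorem AddSubgroup.card_le_prime_pow {G : Type*} [AddGroup G] [Finite G] {p d : ℕ}
    (hp : p.Prime) (hG : Nat.card G = p ^ (d + 1)) {H : AddSubgroup G} (hH : H ≠ ⊤) :
    Nat.card H ≤ p ^ d := by
  have hdvd := H.card_addSubgroup_dvd_card
  rw [hG] at hdvd
  obtain ⟨j, hj, hjH⟩ := (Nat.dvd_prime_pow hp).1 hdvd
  rw [hjH]
  refine Nat.pow_le_pow_right hp.pos (Nat.lt_succ_iff.1 (lt_of_le_of_ne hj ?_))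
  rintro rfl
  exact hH (AddSubgroup.eq_top_of_card_eq H (hjH.trans hG.symm))

theorem sum_ncard_add_sum_ncard_le_of_disjoint {G : Type*} [AddCommGroup G] [Finite G]
    {p d : ℕ} (hp : p.Prime) (hG : Nat.card G = p ^ (d + 1)) {k l : ℕ} (hk : 1 ≤ k) (hl : 1 ≤ l)
    {X : Fin k → Set G} {Y : Fin l → Set G} (hX : ∀ i, (X i).Nonempty)
    (hY : ∀ j, (Y j).Nonempty) (hXY : Disjoint (∑ i, X i) (∑ j, Y j)) :
    ∑ i, (X i).ncard + ∑ j, (Y j).ncard ≤ (p + k + l - 2) * p ^ d := by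
  obtain ⟨k, rfl⟩ := Nat.exists_eq_add_of_le' hk
  obtain ⟨l, rfl⟩ := Nat.exists_eq_add_of_le' hl
  have hM : ∀ H : AddSubgroup G, H ≠ ⊤ → Nat.card H ≤ p ^ d :=
    fun H hH ↦ AddSubgroup.card_le_prime_pow hp hG hH
  choose x hx using hX
  choose y hy using hY
  have hxS : ∑ i, x i ∈ ∑ i, X i := Set.finsetSum_mem_finsetSum _ _ _ fun i _ ↦ hx i
  have hyT : ∑ j, y j ∈ ∑ j, Y j := Set.finsetSum_mem_finsetSum _ _ _ fun j _ ↦ hy j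
  have hS : ∑ i, X i ≠ Set.univ := fun h ↦ Set.disjoint_left.1 hXY (h ▸ Set.mem_univ _) hyT
  have hT : ∑ j, Y j ≠ Set.univ := fun h ↦ Set.disjoint_left.1 hXY hxS (h ▸ Set.mem_univ _)
  have h₁ := sum_ncard_le_ncard_sum hM (fun i ↦ ⟨x i, hx i⟩) hS
  have h₂ := sum_ncard_le_ncard_sum hM (fun j ↦ ⟨y j, hy j⟩) hT
  have h₃ : (∑ i, X i).ncard + (∑ j, Y j).ncard ≤ p ^ (d + 1) := by
    rw [← hG, ← Set.ncard_union_eq hXY, ← Set.ncard_univ]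
    exact Set.ncard_le_ncard (Set.subset_univ _) (Set.toFinite _)
  rw [show p + (k + 1) + (l + 1) - 2 = p + k + l by omega]
  rw [pow_succ] at h₃
  linarith

theorem itSum_eq_sum {G : Type*} [AddCommMonoid G] (h : ℕ) (A : Set G) :
    itSum h A = ∑ _i : Fin h, A := by
  induction h with
  | zero => rfl
  | succ h ih => rw [Fin.sum_univ_castSucc, ← ih]; rfl

theorem sum_mem_itSum {G : Type*} [AddCommMonoid G] {h : ℕ} {A : Set G} {f : Fin h → G}
    (hf : ∀ i, f i ∈ A) : ∑ i, f i ∈ itSum h A := by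
  rw [itSum_eq_sum]
  exact Set.finsetSum_mem_finsetSum _ _ _ fun i _ ↦ hf i

theorem layerKL_nonempty_of_le_weight {p n : ℕ} [NeZero p] {v : Fin n → ZMod p}
    {K : Submodule (ZMod p) (Fin n → ZMod p)} {A : Set (Fin n → ZMod p)} {b : ℕ → ZMod p}
    (hb : Set.SurjOn b (Set.Icc 1 p) Set.univ)
    (hmono : ∀ i j : ℕ, 1 ≤ i → i ≤ j → j ≤ p →
      (layerKL v K A (b j)).ncard ≤ (layerKL v K A (b i)).ncard)
    {i : ℕ} (hi : 1 ≤ i) (hiw : i ≤ weight v K A) : (layerKL v K A (b i)).Nonempty := by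
  by_contra hne
  have hsub : supp v K A ⊆ b '' Set.Icc 1 (i - 1) := by
    intro x hx
    obtain ⟨j, hj, rfl⟩ := hb (Set.mem_univ x)
    refine ⟨j, ⟨hj.1, ?_⟩, rfl⟩
    by_contra! hij
    have := hmono i j hi (by omega) hj.2
    rw [Set.not_nonempty_iff_eq_empty.1 hne, Set.ncard_empty, Nat.le_zero,
      Set.ncard_eq_zero (Set.toFinite _)] at this
    exact hx.ne_empty this
  have h₁ := (Set.ncard_le_ncard hsub (Set.toFinite _)).trans (Set.ncard_image_le (Set.toFinite _))
  rw [← Finset.coe_Icc, Set.ncard_coe_finset, Nat.card_Icc] at h₁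
  rw [weight] at hiw
  omega

theorem ncard_layerKL {p n : ℕ} (v : Fin n → ZMod p)
    (K : Submodule (ZMod p) (Fin n → ZMod p)) (A : Set (Fin n → ZMod p)) (i : ZMod p) :
    {x : K | (x : Fin n → ZMod p) + i • v ∈ A}.ncard = (layerKL v K A i).ncard := by
  rw [← Set.ncard_image_of_injective _ Subtype.val_injective]
  congr 1
  ext x
  simp [layerKL, and_comm]

theorem disjoint_sum_layers {k l p n : ℕ} {A : Set (Fin n → ZMod p)} (hfree : KLFree k l A)
    (v : Fin n → ZMod p) (K : Submodule (ZMod p) (Fin n → ZMod p))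
    {c : Fin k → ZMod p} {d : Fin l → ZMod p} (hcd : ∑ i, c i = ∑ j, d j) :
    Disjoint (∑ i, {x : K | (x : Fin n → ZMod p) + c i • v ∈ A})
      (∑ j, {x : K | (x : Fin n → ZMod p) + d j • v ∈ A}) := by
  rw [Set.disjoint_left]
  intro z hz hz'
  obtain ⟨f, hf, rfl⟩ := (Set.mem_fintype_sum _ _).1 hz
  obtain ⟨g, hg, hgf⟩ := (Set.mem_fintype_sum _ _).1 hz'
  have hF := sum_mem_itSum (f := fun i ↦ (f i : Fin n → ZMod p) + c i • v) hf
  have hg' := sum_mem_itSum (f := fun j ↦ (g j : Fin n → ZMod p) + d j • v) hg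
  have heq : ∑ j, ((g j : Fin n → ZMod p) + d j • v) =
      ∑ i, ((f i : Fin n → ZMod p) + c i • v) := by
    rw [Finset.sum_add_distrib, Finset.sum_add_distrib, ← Finset.sum_smul, ← Finset.sum_smul, hcd]
    congr 1
    exact_mod_cast congrArg (Subtype.val) hgf
  rw [heq] at hg'
  exact (Set.ext_iff.1 hfree _).1 ⟨hF, hg'⟩

/-- If indices `r_1,…,r_k,s_1,…,s_ℓ ∈ {1,…,ω}` satisfy
`(C_{r_1}+⋯+C_{r_k}) ∩ (C_{s_1}+⋯+C_{s_ℓ}) ≠ ∅` or `Σr_i + Σs_j ≥ p+k+ℓ-1`, then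
`Σ|A_{b_{r_i}}| + Σ|A_{b_{s_j}}| ≤ (p+k+ℓ-2)·p^(n-2)`. -/
theorem stmt12 (k l n m lam p : ℕ) (hlk : l < k) (hl : 1 ≤ l) (hn : 2 ≤ n) (hm : 1 ≤ m)
    (hlam : lam ≤ k + l - 3) (hp : p = (k + l) * m + 2 + lam) (hpp : p.Prime)
    (A : Set (Fin n → ZMod p)) (hA : A.Nonempty) (hfree : KLFree k l A)
    (v : Fin n → ZMod p) (K : Submodule (ZMod p) (Fin n → ZMod p))
    (hK : Module.finrank (ZMod p) K = n - 1) (hv : v ∉ K)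
    (b : ℕ → ZMod p) (hb : Set.BijOn b (Set.Icc 1 p) Set.univ)
    (hmono : ∀ i j : ℕ, 1 ≤ i → i ≤ j → j ≤ p →
      (layerKL v K A (b j)).ncard ≤ (layerKL v K A (b i)).ncard)
    (r : Fin k → ℕ) (s : Fin l → ℕ)
    (hr : ∀ i, 1 ≤ r i ∧ r i ≤ weight v K A)
    (hs : ∀ j, 1 ≤ s j ∧ s j ≤ weight v K A)
    (hcond : ((∑ i, (b '' Set.Icc 1 (r i)) : Set (ZMod p)) ∩
          (∑ j, (b '' Set.Icc 1 (s j)))).Nonempty ∨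
        p + k + l - 1 ≤ (∑ i, r i) + (∑ j, s j)) :
    (∑ i, (layerKL v K A (b (r i))).ncard) + (∑ j, (layerKL v K A (b (s j))).ncard) ≤
      (p + k + l - 2) * p ^ (n - 2) := by
  have : Fact p.Prime := ⟨hpp⟩
  have hw : weight v K A ≤ p := by
    have := Set.ncard_le_ncard (Set.subset_univ (supp v K A)) (Set.toFinite _)
    rwa [Set.ncard_univ, Nat.card_zmod] at this
  have hC : ∀ t, t ≤ weight v K A → (b '' Set.Icc 1 t).ncard = t := by
    intro t ht
    rw [(hb.injOn.mono (Set.Icc_subset_Icc_right (ht.trans hw))).ncard_image,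
      ← Finset.coe_Icc, Set.ncard_coe_finset, Nat.card_Icc, Nat.add_sub_cancel]
  have hinter : ((∑ i, (b '' Set.Icc 1 (r i)) : Set (ZMod p)) ∩
      (∑ j, (b '' Set.Icc 1 (s j)))).Nonempty := by
    refine hcond.elim id fun hle ↦ ?_
    by_contra hne
    have hdisj := Set.disjoint_iff_inter_eq_empty.2 (Set.not_nonempty_iff_eq_empty.1 hne)
    have := sum_ncard_add_sum_ncard_le_of_disjoint (d := 0) hpp (by simp) (by omega) hl
      (X := fun i ↦ b '' Set.Icc 1 (r i)) (Y := fun j ↦ b '' Set.Icc 1 (s j))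
      (fun i ↦ ⟨b 1, 1, ⟨le_rfl, (hr i).1⟩, rfl⟩) (fun j ↦ ⟨b 1, 1, ⟨le_rfl, (hs j).1⟩, rfl⟩) hdisj
    simp only [hC _ (hr _).2, hC _ (hs _).2, pow_zero, mul_one] at this
    omega
  obtain ⟨z, hz, hz'⟩ := hinter
  obtain ⟨c, hc, rfl⟩ := (Set.mem_fintype_sum _ _).1 hz
  obtain ⟨d, hd, hdc⟩ := (Set.mem_fintype_sum _ _).1 hz'
  choose! i hi hic using hc
  choose! j hj hjd using hd
  have hKcard : Nat.card K = p ^ (n - 2 + 1) := by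
    rw [Module.natCard_eq_pow_finrank (K := ZMod p), Nat.card_zmod, hK]
    congr 1
    omega
  have hne : ∀ t, 1 ≤ t → t ≤ weight v K A →
      {x : K | (x : Fin n → ZMod p) + b t • v ∈ A}.Nonempty := by
    intro t ht htw
    obtain ⟨x, hx, hxA⟩ := layerKL_nonempty_of_le_weight hb.surjOn hmono ht htw
    exact ⟨⟨x, hx⟩, hxA⟩
  have key := sum_ncard_add_sum_ncard_le_of_disjoint hpp hKcard (by omega) hl
    (fun q ↦ hic q ▸ hne (i q) (hi q).1 ((hi q).2.trans (hr q).2))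
    (fun q ↦ hjd q ▸ hne (j q) (hj q).1 ((hj q).2.trans (hs q).2))
    (disjoint_sum_layers hfree v K hdc.symm)
  simp only [ncard_layerKL] at key
  refine le_trans (add_le_add (Finset.sum_le_sum fun q _ ↦ ?_)
    (Finset.sum_le_sum fun q _ ↦ ?_)) key
  · rw [← hic q]
    exact hmono _ _ (hi q).1 (hi q).2 ((hr q).2.trans hw)
  · rw [← hjd q]
    exact hmono _ _ (hj q).1 (hj q).2 ((hs q).2.trans hw)
end
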